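/- arXiv:2502.18222 — 4 statements merged into one kernel-verified Lean document; each statement's English description precedes it below -/
import Mathlib

section
/- Let Z be an m × n matrix of variables over a field k of characteristic zero, r < min(m,n), and Ω ⊆ [m] × [n] with Ω = ⋃_j ω_j × {j}. If |ω_j| < r for some j ∈ [n], then Ω is not uniquely completable at rank r; in fact the transcendence degree over k of the field generated by the residues Z̄_Ω in Frac(k[Z]/I_{r+1}(Z)) is strictly less than r(m+n−r). -/
open MvPolynomial

/-- The ideal of `(r+1)`-minors of the generic `m × n` matrix of variables. -/
noncomputable def detIdeal (k : Type*) [CommRing k] (m n r : ℕ) :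
    Ideal (MvPolynomial (Fin m × Fin n) k) :=
  Ideal.span { p | ∃ f : Fin (r + 1) → Fin m, ∃ g : Fin (r + 1) → Fin n,
    Function.Injective f ∧ Function.Injective g ∧
    p = (Matrix.of fun i j => (X (f i, g j) : MvPolynomial (Fin m × Fin n) k)).det }

/-- `Ω` is uniquely completable at rank `r`: `k(Z̄_Ω) = k(Z̄)`, i.e. every residue `z̄_{ij}`
can be written as a quotient `ā/b̄` with `a, b ∈ k[Z_Ω]` and `b̄ ≠ 0` modulo `I_{r+1}(Z)`. -/
def UniquelyCompletable (k : Type*) [Field k] (m n r : ℕ) (Ω : Finset (Fin m × Fin n)) : Prop :=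
  ∀ p : Fin m × Fin n, ∃ a b : MvPolynomial (Fin m × Fin n) k,
    a ∈ MvPolynomial.supported k (↑Ω : Set (Fin m × Fin n)) ∧
    b ∈ MvPolynomial.supported k (↑Ω : Set (Fin m × Fin n)) ∧
    Ideal.Quotient.mk (detIdeal k m n r) b ≠ 0 ∧
    Ideal.Quotient.mk (detIdeal k m n r) b * Ideal.Quotient.mk (detIdeal k m n r) (X p) =
      Ideal.Quotient.mk (detIdeal k m n r) a


namespace SmallCol

/-- Rearrangement, part 1: Abel summation weights. -/
lemma rearr {m n : ℕ} (A B : Fin m → Fin n → ℕ)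
    (hrow : ∀ i, ∑ j, A i j = ∑ j, B i j) (hcolm : ∀ j, ∑ i, A i j = ∑ i, B i j)
    (hA : ∀ i j i' j', i < i' → j < j' → A i j ≠ 0 → A i' j' ≠ 0 → False) :
    (∑ i : Fin m, ∑ j : Fin n, ((i : ℕ) + 1) * ((j : ℕ) + 1) * A i j ≤
      ∑ i : Fin m, ∑ j : Fin n, ((i : ℕ) + 1) * ((j : ℕ) + 1) * B i j) ∧
    ((∑ i : Fin m, ∑ j : Fin n, ((i : ℕ) + 1) * ((j : ℕ) + 1) * A i j =
      ∑ i : Fin m, ∑ j : Fin n, ((i : ℕ) + 1) * ((j : ℕ) + 1) * B i j) → A = B) := by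
  classical
  set D : Fin m → Fin n → ℤ := fun i j => (B i j : ℤ) - A i j with hD
  have hDr : ∀ i, ∑ j, D i j = 0 := by
    intro i
    have := hrow i
    simp only [hD, Finset.sum_sub_distrib]
    have h2 : (∑ j, (A i j : ℤ)) = ∑ j, (B i j : ℤ) := by exact_mod_cast this
    omega
  have hDc : ∀ j, ∑ i, D i j = 0 := by
    intro j
    have := hcolm j
    simp only [hD, Finset.sum_sub_distrib]
    have h2 : (∑ i, (A i j : ℤ)) = ∑ i, (B i j : ℤ) := by exact_mod_cast this
    omega
  set N : ℕ → ℕ → ℤ := fun p q => ∑ i : Fin m, ∑ j : Fin n,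
    (if p ≤ (i : ℕ) then 1 else 0) * (if q ≤ (j : ℕ) then 1 else 0) * D i j with hN
  set N' : ℕ → ℕ → ℤ := fun p q => ∑ i : Fin m, ∑ j : Fin n,
    (if p ≤ (i : ℕ) then 0 else 1) * (if q ≤ (j : ℕ) then 0 else 1) * D i j with hN'
  have hNN : ∀ p q, N p q = N' p q := by
    intro p q
    have e : N p q - N' p q =
        (∑ i : Fin m, (if p ≤ (i : ℕ) then 1 else 0) * ∑ j, D i j) +
        (∑ j : Fin n, (if q ≤ (j : ℕ) then 1 else 0) * ∑ i, D i j) - ∑ i, ∑ j, D i j := by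
      simp only [hN, hN', Finset.mul_sum]
      rw [Finset.sum_comm (s := (Finset.univ : Finset (Fin n)))]
      simp only [← Finset.sum_sub_distrib, ← Finset.sum_add_distrib]
      refine Finset.sum_congr rfl fun i _ => Finset.sum_congr rfl fun j _ => ?_
      split_ifs <;> ring
    simp only [hDr, hDc] at e
    simp at e
    omega
  have hNpos : ∀ p q, 0 ≤ N p q := by
    intro p q
    by_cases h : ∃ i j, p ≤ (i : Fin m).val ∧ q ≤ (j : Fin n).val ∧ A i j ≠ 0
    · obtain ⟨i', j', hp, hq, h'⟩ := h
      rw [hNN]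
      refine Finset.sum_nonneg fun i _ => Finset.sum_nonneg fun j _ => ?_
      split_ifs with h1 h2
      · simp
      · simp
      · simp
      · have : A i j = 0 := by
          by_contra h0
          exact hA i j i' j' (by rw [Fin.lt_def]; omega) (by rw [Fin.lt_def]; omega) h0 h'
        simp [hD, this]
    · push Not at h
      refine Finset.sum_nonneg fun i _ => Finset.sum_nonneg fun j _ => ?_
      split_ifs with h1 h2
      · simp [hD, h i j h1 h2]
      · simp
      · simp
      · simp
  have hcount : ∀ (M : ℕ) (i : Fin M), ∑ p ∈ Finset.range M,
      (if p ≤ (i : ℕ) then (1 : ℤ) else 0) = (i : ℕ) + 1 := by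
    intro M i
    rw [← Finset.sum_filter, Finset.sum_const]
    have : (Finset.range M).filter (fun p => p ≤ (i : ℕ)) = Finset.range (i + 1) := by
      ext p; simp; omega
    rw [this]; simp
  have hw : (∑ i : Fin m, ∑ j : Fin n, (((i : ℕ) + 1) * ((j : ℕ) + 1) * D i j : ℤ)) =
      ∑ p ∈ Finset.range m, ∑ q ∈ Finset.range n, N p q := by
    simp only [hN]
    have : ∀ p ∈ Finset.range m, ∑ q ∈ Finset.range n, ∑ i : Fin m, ∑ j : Fin n,
        (if p ≤ (i : ℕ) then (1 : ℤ) else 0) * (if q ≤ (j : ℕ) then 1 else 0) * D i j =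
        ∑ i : Fin m, ∑ j : Fin n, (if p ≤ (i : ℕ) then (1 : ℤ) else 0) * ((j : ℕ) + 1) * D i j := by
      intro p _
      rw [Finset.sum_comm]
      refine Finset.sum_congr rfl fun i _ => ?_
      rw [Finset.sum_comm]
      refine Finset.sum_congr rfl fun j _ => ?_
      rw [← Finset.sum_mul, ← Finset.mul_sum, hcount]
    refine Eq.symm ((Finset.sum_congr rfl this).trans ?_)
    rw [Finset.sum_comm]
    refine Finset.sum_congr rfl fun i _ => ?_
    rw [Finset.sum_comm]
    refine Finset.sum_congr rfl fun j _ => ?_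
    rw [← Finset.sum_mul, ← Finset.sum_mul, hcount]
  have hw2 : (∑ i : Fin m, ∑ j : Fin n, (((i : ℕ) + 1) * ((j : ℕ) + 1) * D i j : ℤ)) =
      ((∑ i : Fin m, ∑ j : Fin n, ((i : ℕ) + 1) * ((j : ℕ) + 1) * B i j : ℕ) : ℤ) -
      ((∑ i : Fin m, ∑ j : Fin n, ((i : ℕ) + 1) * ((j : ℕ) + 1) * A i j : ℕ) : ℤ) := by
    push_cast
    simp only [← Finset.sum_sub_distrib, hD, mul_sub]
  have hnn : 0 ≤ ∑ p ∈ Finset.range m, ∑ q ∈ Finset.range n, N p q :=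
    Finset.sum_nonneg fun p _ => Finset.sum_nonneg fun q _ => hNpos p q
  refine ⟨by omega, fun heq => ?_⟩
  have hz : ∑ p ∈ Finset.range m, ∑ q ∈ Finset.range n, N p q = 0 := by omega
  have hN0 : ∀ p q, N p q = 0 := by
    intro p q
    by_cases hp : p < m
    · by_cases hq : q < n
      · rw [Finset.sum_eq_zero_iff_of_nonneg
          (fun p _ => Finset.sum_nonneg fun q _ => hNpos p q)] at hz
        have := hz p (by simpa using hp)
        rw [Finset.sum_eq_zero_iff_of_nonneg (fun q _ => hNpos p q)] at this
        exact this q (by simpa using hq)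
      · refine Finset.sum_eq_zero fun i _ => Finset.sum_eq_zero fun j _ => ?_
        rw [if_neg (show ¬ q ≤ (j : ℕ) by omega)]; simp
    · refine Finset.sum_eq_zero fun i _ => Finset.sum_eq_zero fun j _ => ?_
      rw [if_neg (show ¬ p ≤ (i : ℕ) by omega)]; simp
  funext i j
  have key : D i j = N i j - N (i + 1) j - N i (j + 1) + N (i + 1) (j + 1) := by
    simp only [hN, ← Finset.sum_sub_distrib, ← Finset.sum_add_distrib]
    rw [Finset.sum_eq_single i, Finset.sum_eq_single j]
    · simp
    · intro j' _ hj'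
      have : (j' : ℕ) ≠ j := fun h => hj' (Fin.ext h)
      by_cases h : (j : ℕ) ≤ j'
      · simp [h, show (j : ℕ) + 1 ≤ j' by omega]
      · simp [h, show ¬ (j : ℕ) + 1 ≤ j' by omega]
    · simp
    · intro i' _ hi'
      have : (i' : ℕ) ≠ i := fun h => hi' (Fin.ext h)
      refine Finset.sum_eq_zero fun j' _ => ?_
      by_cases h : (i : ℕ) ≤ i'
      · simp [h, show (i : ℕ) + 1 ≤ i' by omega]
      · simp [h, show ¬ (i : ℕ) + 1 ≤ i' by omega]
    · simp
  simp only [hN0] at key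
  simp only [hD] at key
  omega

/-- weight of an exponent vector -/
def wt {m n : ℕ} (s : (Fin m × Fin n) →₀ ℕ) : ℕ :=
  ∑ i : Fin m, ∑ j : Fin n, ((i : ℕ) + 1) * ((j : ℕ) + 1) * s (i, j)

lemma wt_add {m n : ℕ} (s t : (Fin m × Fin n) →₀ ℕ) : wt (s + t) = wt s + wt t := by
  simp [wt, mul_add, Finset.sum_add_distrib]

lemma wt_single {m n : ℕ} (i : Fin m) (j : Fin n) :
    wt (Finsupp.single (i, j) 1) = ((i : ℕ) + 1) * ((j : ℕ) + 1) := by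
  unfold wt
  rw [Finset.sum_eq_single i, Finset.sum_eq_single j]
  · simp
  · intro j' _ h; simp [h.symm]
  · simp
  · intro i' _ h; simp [h.symm]
  · simp

/-- an exponent vector is good if its support has no strict chain of length `r+1` -/
def Good {m n : ℕ} (r : ℕ) (s : (Fin m × Fin n) →₀ ℕ) : Prop :=
  ¬ ∃ f : Fin (r + 1) → Fin m, ∃ g : Fin (r + 1) → Fin n, StrictMono f ∧ StrictMono g ∧
    ∀ t, s (f t, g t) ≠ 0

/-- chains of length `c + 1` ending at `p` -/
def Ch {m n : ℕ} (s : (Fin m × Fin n) →₀ ℕ) : ℕ → Fin m × Fin n → Prop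
  | 0, p => s p ≠ 0
  | c + 1, p => s p ≠ 0 ∧ ∃ q, Ch s c q ∧ q.1 < p.1 ∧ q.2 < p.2

lemma Ch.extract {m n : ℕ} (s : (Fin m × Fin n) →₀ ℕ) (c : ℕ) : ∀ p, Ch s c p →
    ∃ f : Fin (c + 1) → Fin m, ∃ g : Fin (c + 1) → Fin n, StrictMono f ∧ StrictMono g ∧
    (∀ t, s (f t, g t) ≠ 0) ∧ f (Fin.last c) = p.1 ∧ g (Fin.last c) = p.2 := by
  induction c with
  | zero =>
    intro p hp
    exact ⟨fun _ => p.1, fun _ => p.2, fun a b h => absurd h (by omega), fun a b h => absurd h (by omega),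
      fun _ => hp, rfl, rfl⟩
  | succ c ih =>
    rintro p ⟨hp, q, hq, h1, h2⟩
    obtain ⟨f, g, hf, hg, hs, hfl, hgl⟩ := ih q hq
    refine ⟨Fin.snoc (α := fun _ => Fin m) f p.1, Fin.snoc (α := fun _ => Fin n) g p.2,
      ?_, ?_, ?_, by simp, by simp⟩
    · rw [Fin.strictMono_iff_lt_succ]
      intro i
      refine Fin.lastCases ?_ (fun i => ?_) i
      · rw [Fin.succ_last, Fin.snoc_last, Fin.snoc_castSucc, hfl]; exact h1
      · rw [← Fin.castSucc_succ, Fin.snoc_castSucc, Fin.snoc_castSucc]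
        exact hf Fin.castSucc_lt_succ
    · rw [Fin.strictMono_iff_lt_succ]
      intro i
      refine Fin.lastCases ?_ (fun i => ?_) i
      · rw [Fin.succ_last, Fin.snoc_last, Fin.snoc_castSucc, hgl]; exact h2
      · rw [← Fin.castSucc_succ, Fin.snoc_castSucc, Fin.snoc_castSucc]
        exact hg Fin.castSucc_lt_succ
    · intro t
      refine Fin.lastCases ?_ (fun i => ?_) t
      · simpa using hp
      · simpa using hs i

lemma Good.label {m n r : ℕ} {s : (Fin m × Fin n) →₀ ℕ} (hs : Good r s) :
    ∃ l : Fin m × Fin n → ℕ, (∀ p, s p ≠ 0 → l p < r) ∧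
      ∀ p q, s p ≠ 0 → s q ≠ 0 → p.1 < q.1 → p.2 < q.2 → l p < l q := by
  classical
  have hr : ∀ p, ¬ Ch s r p := by
    intro p hp
    obtain ⟨f, g, hf, hg, h, -⟩ := Ch.extract s r p hp
    exact hs ⟨f, g, hf, hg, h⟩
  have hmem : ∀ p, s p ≠ 0 → Ch s (Nat.findGreatest (fun c => Ch s c p) r) p := fun p hp =>
    Nat.findGreatest_spec (P := fun c => Ch s c p) (Nat.zero_le r) hp
  have hlt : ∀ p, s p ≠ 0 → Nat.findGreatest (fun c => Ch s c p) r < r := by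
    intro p hp
    refine lt_of_le_of_ne (Nat.findGreatest_le r) fun h => ?_
    have := hmem p hp
    rw [h] at this
    exact hr p this
  refine ⟨fun p => Nat.findGreatest (fun c => Ch s c p) r, hlt, ?_⟩
  intro p q hp hq h1 h2
  exact Nat.le_findGreatest (P := fun c => Ch s c q) (Nat.succ_le_of_lt (hlt p hp))
    ⟨hq, p, hmem p hp, h1, h2⟩

/-- variables of the factor matrices -/
abbrev V (m n r : ℕ) := (Fin m × Fin r) ⊕ (Fin r × Fin n)

/-- entries of the product of the generic factor matrices -/
noncomputable def entry (R : Type*) [CommSemiring R] (m n r : ℕ) (p : Fin m × Fin n) :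
    MvPolynomial (V m n r) R :=
  ∑ a : Fin r, X (Sum.inl (p.1, a)) * X (Sum.inr (a, p.2))

/-- the substitution `Z = X Y` -/
noncomputable def phi (R : Type*) [CommSemiring R] (m n r : ℕ) :
    MvPolynomial (Fin m × Fin n) R →ₐ[R] MvPolynomial (V m n r) R :=
  aeval (entry R m n r)

section
variable {m n r : ℕ}

/-- forget labels -/
noncomputable def tot (c : (Fin r × Fin m × Fin n) →₀ ℕ) : (Fin m × Fin n) →₀ ℕ :=
  c.mapDomain Prod.snd

/-- label monomial -/
noncomputable def lab (c : (Fin r × Fin m × Fin n) →₀ ℕ) : V m n r →₀ ℕ :=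
  c.mapDomain (fun t => Sum.inl (t.2.1, t.1)) + c.mapDomain (fun t => Sum.inr (t.1, t.2.2))

lemma tot_add (c d : (Fin r × Fin m × Fin n) →₀ ℕ) : tot (c + d) = tot c + tot d :=
  Finsupp.mapDomain_add

lemma lab_add (c d : (Fin r × Fin m × Fin n) →₀ ℕ) : lab (c + d) = lab c + lab d := by
  simp only [lab, Finsupp.mapDomain_add]; abel

lemma finsupp_ind {α : Type*} {P : (α →₀ ℕ) → Prop} (h0 : P 0)
    (hadd : ∀ f g, P f → P g → P (f + g)) (h1 : ∀ a, P (Finsupp.single a 1)) (f) : P f := by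
  induction f using Finsupp.induction_linear with
  | zero => exact h0
  | add f g hf hg => exact hadd f g hf hg
  | single a b =>
    induction b with
    | zero => simpa using h0
    | succ b ih => rw [Finsupp.single_add]; exact hadd _ _ ih (h1 a)

lemma tot_apply (c : (Fin r × Fin m × Fin n) →₀ ℕ) (i j) : tot c (i, j) = ∑ a, c (a, i, j) := by
  induction c using finsupp_ind with
  | h0 => simp [tot]
  | hadd f g hf hg => simp [tot_add, hf, hg, Finset.sum_add_distrib]
  | h1 t =>
    obtain ⟨a, i', j'⟩ := t
    simp only [tot, Finsupp.mapDomain_single, Finsupp.single_apply, Prod.mk.injEq]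
    rw [Finset.sum_eq_single a] <;> simp +contextual [eq_comm]

lemma lab_inl (c : (Fin r × Fin m × Fin n) →₀ ℕ) (i a) :
    lab c (Sum.inl (i, a)) = ∑ j, c (a, i, j) := by
  induction c using finsupp_ind with
  | h0 => simp [lab]
  | hadd f g hf hg => simp [lab_add, hf, hg, Finset.sum_add_distrib]
  | h1 t =>
    obtain ⟨a', i', j'⟩ := t
    simp only [lab, Finsupp.mapDomain_single, Finsupp.add_apply, Finsupp.single_apply,
      Prod.mk.injEq, Sum.inl.injEq, reduceCtorEq, if_false, add_zero]
    rw [Finset.sum_eq_single j'] <;> simp +contextual [eq_comm, and_comm]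

lemma lab_inr (c : (Fin r × Fin m × Fin n) →₀ ℕ) (a j) :
    lab c (Sum.inr (a, j)) = ∑ i, c (a, i, j) := by
  induction c using finsupp_ind with
  | h0 => simp [lab]
  | hadd f g hf hg => simp [lab_add, hf, hg, Finset.sum_add_distrib]
  | h1 t =>
    obtain ⟨a', i', j'⟩ := t
    simp only [lab, Finsupp.mapDomain_single, Finsupp.add_apply, Finsupp.single_apply,
      Prod.mk.injEq, Sum.inr.injEq, reduceCtorEq, if_false, zero_add]
    rw [Finset.sum_eq_single i'] <;> simp +contextual [eq_comm]

lemma entry_eq (p : Fin m × Fin n) : entry ℕ m n r p =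
    ∑ a : Fin r, monomial (lab (Finsupp.single (a, p.1, p.2) 1)) 1 := by
  unfold entry lab
  refine Finset.sum_congr rfl fun a _ => ?_
  simp only [Finsupp.mapDomain_single]
  rw [← mul_one (1 : ℕ), ← monomial_mul]
  simp [X]

lemma phi_single (p : Fin m × Fin n) :
    phi ℕ m n r (monomial (Finsupp.single p 1) 1) = entry ℕ m n r p := by
  rw [phi]; exact aeval_X _ p

lemma claimA (B : (Fin m × Fin n) →₀ ℕ) : ∀ d, coeff d (phi ℕ m n r (monomial B 1)) ≠ 0 →
    ∃ c, tot c = B ∧ lab c = d := by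
  classical
  induction B using finsupp_ind with
  | h0 =>
    intro d hd
    have : (monomial (0 : (Fin m × Fin n) →₀ ℕ) (1 : ℕ)) = 1 := rfl
    rw [this, map_one, coeff_one] at hd
    refine ⟨0, by simp [tot], ?_⟩
    by_contra h
    apply hd
    rw [if_neg]
    rintro rfl
    simp [lab] at h
  | hadd f g hf hg =>
    intro d hd
    rw [← mul_one (1 : ℕ), ← monomial_mul, map_mul, coeff_mul] at hd
    obtain ⟨x, hx, hne⟩ := Finset.exists_ne_zero_of_sum_ne_zero hd
    obtain ⟨c1, h1, h2⟩ := hf x.1 (left_ne_zero_of_mul hne)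
    obtain ⟨c2, h3, h4⟩ := hg x.2 (right_ne_zero_of_mul hne)
    refine ⟨c1 + c2, by rw [tot_add, h1, h3], ?_⟩
    rw [lab_add, h2, h4]
    simpa using hx
  | h1 p =>
    intro d hd
    rw [phi_single, entry_eq, coeff_sum] at hd
    obtain ⟨a, -, hne⟩ := Finset.exists_ne_zero_of_sum_ne_zero hd
    rw [coeff_monomial] at hne
    refine ⟨Finsupp.single (a, p.1, p.2) 1, by simp [tot], ?_⟩
    by_contra h
    simp [h] at hne

lemma claimB (c : (Fin r × Fin m × Fin n) →₀ ℕ) :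
    coeff (lab c) (phi ℕ m n r (monomial (tot c) 1)) ≠ 0 := by
  classical
  induction c using finsupp_ind with
  | h0 =>
    have : (monomial (tot (0 : (Fin r × Fin m × Fin n) →₀ ℕ)) (1 : ℕ)) = 1 := by
      simp [tot]
    rw [this, map_one]
    simp [lab]
  | hadd f g hf hg =>
    rw [tot_add, lab_add, ← mul_one (1 : ℕ), ← monomial_mul, map_mul, coeff_mul]
    intro h
    rw [Finset.sum_eq_zero_iff] at h
    exact mul_ne_zero hf hg (h (lab f, lab g) (by simp))
  | h1 t =>
    obtain ⟨a, i, j⟩ := t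
    have : tot (Finsupp.single (a, i, j) 1) = Finsupp.single (i, j) 1 := by simp [tot]
    rw [this, phi_single, entry_eq, coeff_sum]
    intro h
    rw [Finset.sum_eq_zero_iff] at h
    have := h a (Finset.mem_univ _)
    simp at this

/-- key triangularity -/
lemma triangular {s : (Fin m × Fin n) →₀ ℕ} (hs : Good r s) :
    ∃ d : V m n r →₀ ℕ, coeff d (phi ℕ m n r (monomial s 1)) ≠ 0 ∧
      ∀ B, coeff d (phi ℕ m n r (monomial B 1)) ≠ 0 → B ≠ s → wt s < wt B := by
  classical
  obtain ⟨l, hl, hlt⟩ := hs.label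
  let c : (Fin r × Fin m × Fin n) →₀ ℕ := Finsupp.equivFunOnFinite.symm
    fun t => if l t.2 = t.1 then s t.2 else 0
  have hc : ∀ a i j, c (a, i, j) = if l (i, j) = a then s (i, j) else 0 := fun a i j => rfl
  have htot : tot c = s := by
    ext ⟨i, j⟩
    rw [tot_apply]
    by_cases h0 : s (i, j) = 0
    · simp [hc, h0]
    · rw [Finset.sum_eq_single ⟨l (i, j), hl _ h0⟩]
      · simp [hc]
      · intro b _ hb
        rw [hc, if_neg]
        intro h
        exact hb (Fin.ext h.symm)
      · simp
  have hwt : ∀ b : (Fin r × Fin m × Fin n) →₀ ℕ, wt (tot b) = ∑ a, ∑ i : Fin m, ∑ j : Fin n,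
      ((i : ℕ) + 1) * ((j : ℕ) + 1) * b (a, i, j) := by
    intro b
    simp only [wt, tot_apply, Finset.mul_sum]
    rw [Finset.sum_comm (s := (Finset.univ : Finset (Fin r)))]
    refine Finset.sum_congr rfl fun i _ => ?_
    rw [Finset.sum_comm]
  refine ⟨lab c, ?_, ?_⟩
  · have := claimB c
    rwa [htot] at this
  · intro B hB hne
    obtain ⟨b, rfl, hb⟩ := claimA B _ hB
    have key := fun a : Fin r => rearr (fun i j => c (a, i, j)) (fun i j => b (a, i, j))
      (fun i => by rw [← lab_inl, ← lab_inl, hb]) (fun j => by rw [← lab_inr, ← lab_inr, hb])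
      (by
        intro i j i' j' hi hj h1 h2
        simp only [hc, ne_eq, ite_eq_right_iff, not_forall] at h1 h2
        obtain ⟨e1, h1⟩ := h1
        obtain ⟨e2, h2⟩ := h2
        have := hlt (i, j) (i', j') h1 h2 hi hj
        omega)
    have hle : wt s ≤ wt (tot b) := by
      rw [← htot, hwt, hwt]
      exact Finset.sum_le_sum fun a _ => (key a).1
    refine lt_of_le_of_ne hle fun heq => hne ?_
    rw [← htot, hwt, hwt, Finset.sum_eq_sum_iff_of_le (fun a _ => (key a).1)] at heq
    have : b = c := by
      ext ⟨a, i, j⟩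
      have := (key a).2 (heq a (Finset.mem_univ _))
      exact (congrFun (congrFun this i) j).symm
    rw [this, htot]

end

section
variable {k : Type*} [Field k] {m n r : ℕ}

lemma phi_map (s : (Fin m × Fin n) →₀ ℕ) :
    phi k m n r (monomial s 1) = map (Nat.castRingHom k) (phi ℕ m n r (monomial s 1)) := by
  induction s using finsupp_ind with
  | h0 =>
    have h1 : (monomial (0 : (Fin m × Fin n) →₀ ℕ) (1 : ℕ)) = 1 := rfl
    have h2 : (monomial (0 : (Fin m × Fin n) →₀ ℕ) (1 : k)) = 1 := rfl
    rw [h1, h2]; simp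
  | hadd f g hf hg =>
    rw [← mul_one (1 : ℕ), ← mul_one (1 : k), ← monomial_mul, ← monomial_mul, map_mul, map_mul,
      map_mul, hf, hg]
  | h1 p =>
    rw [phi_single]
    have : phi k m n r (monomial (Finsupp.single p 1) 1) = entry k m n r p := by
      rw [phi]; exact aeval_X _ p
    rw [this]
    simp [entry]

lemma indep [CharZero k] (q : MvPolynomial (Fin m × Fin n) k) (hq : ∀ s ∈ q.support, Good r s)
    (h0 : phi k m n r q = 0) : q = 0 := by
  classical
  by_contra hne
  obtain ⟨s, hs, hmax⟩ := Finset.exists_max_image q.support wt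
    (Finset.nonempty_of_ne_empty (fun h => hne (support_eq_empty.mp h)))
  obtain ⟨d, hd, hB⟩ := triangular (hq s hs)
  have hco : coeff d (phi k m n r q) = ∑ t ∈ q.support,
      coeff t q * ((coeff d (phi ℕ m n r (monomial t 1)) : ℕ) : k) := by
    conv_lhs => rw [q.as_sum]
    rw [map_sum, coeff_sum]
    refine Finset.sum_congr rfl fun t _ => ?_
    have : monomial t (coeff t q) = coeff t q • monomial t (1 : k) := by
      rw [smul_monomial]; simp
    rw [this, map_smul, coeff_smul, phi_map, coeff_map]
    simp
  rw [h0, coeff_zero, Finset.sum_eq_single s] at hco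
  · have := mul_ne_zero (mem_support_iff.mp hs) (Nat.cast_ne_zero (R := k).mpr hd)
    exact this hco.symm
  · intro t ht hts
    by_cases h : coeff d (phi ℕ m n r (monomial t 1)) = 0
    · simp [h]
    · exact absurd (hB t h hts) (not_lt.mpr (hmax t ht))
  · intro h; exact absurd hs h

lemma prod_monomial {R : Type*} [CommRing R] {ι : Type*} [Fintype ι] (u : ι → Fin m × Fin n) :
    ∏ t, (X (u t) : MvPolynomial (Fin m × Fin n) R) =
      monomial (∑ t, Finsupp.single (u t) 1) 1 := by
  rw [monomial_sum_one]; rfl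

lemma wt_sum {ι : Type*} [Fintype ι] (u : ι → Fin m) (v : ι → Fin n) :
    wt (∑ t, Finsupp.single (u t, v t) 1) = ∑ t, ((u t : ℕ) + 1) * ((v t : ℕ) + 1) := by
  classical
  have : ∀ s : Finset ι, wt (∑ t ∈ s, Finsupp.single (u t, v t) 1) =
      ∑ t ∈ s, ((u t : ℕ) + 1) * ((v t : ℕ) + 1) := by
    intro s
    induction s using Finset.induction_on with
    | empty => simp [wt]
    | insert a s ha ih => rw [Finset.sum_insert ha, Finset.sum_insert ha, wt_add, ih, wt_single]
  exact this _

lemma spanning (k : Type*) [Field k] {m n : ℕ} (r : ℕ) (N : ℕ) :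
    ∀ s : (Fin m × Fin n) →₀ ℕ, wt s = N →
    monomial s (1 : k) ∈ (detIdeal k m n r).restrictScalars k ⊔ restrictSupport k {t | Good r t} := by
  classical
  induction N using Nat.strong_induction_on with
  | _ N ih =>
  intro s hs
  by_cases hg : Good r s
  · exact Submodule.mem_sup_right ((monomial_mem_restrictSupport k).mpr (Or.inl hg))
  · unfold Good at hg
    push Not at hg
    obtain ⟨f, g, hf, hgm, hne⟩ := hg
    set e : Equiv.Perm (Fin (r + 1)) → (Fin m × Fin n) →₀ ℕ :=
      fun σ => ∑ t, Finsupp.single (f (σ t), g t) 1 with he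
    have hle : e 1 ≤ s := by
      intro p
      simp only [he, Equiv.Perm.coe_one, id_eq, Finsupp.coe_finsetSum, Finset.sum_apply]
      by_cases hp : ∃ t, (f t, g t) = p
      · obtain ⟨t, rfl⟩ := hp
        rw [Finset.sum_eq_single t]
        · simp only [Finsupp.single_eq_same]
          have := hne t
          omega
        · intro b _ hb
          rw [Finsupp.single_apply, if_neg]
          intro h
          exact hb (hf.injective (congrArg Prod.fst h))
        · simp
      · rw [Finset.sum_eq_zero]
        · exact Nat.zero_le _
        · intro t _
          rw [Finsupp.single_apply, if_neg fun h => hp ⟨t, h⟩]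
    obtain ⟨s', rfl⟩ : ∃ s', s = s' + e 1 := ⟨s - e 1, (tsub_add_cancel_of_le hle).symm⟩
    have hlt : ∀ σ : Equiv.Perm (Fin (r + 1)), σ ≠ 1 → wt (e σ) < wt (e 1) := by
      intro σ hσ
      rw [he]
      simp only
      rw [wt_sum (fun t => f (σ t)) g, wt_sum (fun t => f ((1 : Equiv.Perm (Fin (r + 1))) t)) g]
      have hmono : Monovary (fun t => ((f t : ℕ) + 1)) (fun t => ((g t : ℕ) + 1)) := by
        intro a b hab
        have : g a < g b := by rw [Fin.lt_def]; simpa using hab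
        have := hf.monotone ((hgm.lt_iff_lt.mp this).le)
        have : (f a : ℕ) ≤ f b := this
        simpa using this
      refine (hmono.sum_comp_perm_mul_lt_sum_mul_iff (σ := σ)).mpr ?_
      intro hm
      apply hσ
      have hσm : Monotone σ := by
        intro a b hab
        rcases hab.eq_or_lt with rfl | hab
        · exact le_rfl
        · have h1 : (g a : ℕ) < g b := hgm hab
          have := hm (show (g a : ℕ) + 1 < (g b : ℕ) + 1 by omega)
          have h2 : f (σ a) ≤ f (σ b) := by
            rw [Fin.le_def]
            simpa using this
          exact hf.le_iff_le.mp h2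
      have hsm : StrictMono σ := hσm.strictMono_of_injective σ.injective
      ext t
      have : (σ : Fin (r + 1) → Fin (r + 1)) = id := by
        exact StrictMono.eq_id hsm
      simp [this]
    have hdet : (Matrix.of fun i j => (X (f i, g j) : MvPolynomial (Fin m × Fin n) k)).det ∈
        detIdeal k m n r :=
      Ideal.subset_span ⟨f, g, hf.injective, hgm.injective, rfl⟩
    have hexp : (monomial s' (1 : k)) *
        (Matrix.of fun i j => (X (f i, g j) : MvPolynomial (Fin m × Fin n) k)).det =
        ∑ σ : Equiv.Perm (Fin (r + 1)),
          ((Equiv.Perm.sign σ : ℤ) : k) • monomial (s' + e σ) (1 : k) := by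
      rw [Matrix.det_apply', Finset.mul_sum]
      refine Finset.sum_congr rfl fun σ _ => ?_
      simp only [Matrix.of_apply]
      rw [prod_monomial (fun t => (f (σ t), g t)), smul_eq_C_mul, mul_left_comm, monomial_mul]
      simp [he]
    rw [← Finset.add_sum_erase _ _ (Finset.mem_univ 1)] at hexp
    simp only [Equiv.Perm.sign_one, Units.val_one, Int.cast_one, one_smul] at hexp
    rw [← sub_eq_iff_eq_add] at hexp
    rw [← hexp]
    refine Submodule.sub_mem _ (Submodule.mem_sup_left (Ideal.mul_mem_left _ _ hdet)) ?_
    refine Submodule.sum_mem _ fun σ hσ => Submodule.smul_mem _ _ ?_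
    refine ih _ ?_ _ rfl
    have := hlt σ (Finset.ne_of_mem_erase hσ)
    rw [← hs, wt_add, wt_add]
    omega

lemma detIdeal_le (p : MvPolynomial (Fin m × Fin n) k) (hp : p ∈ detIdeal k m n r) :
    phi k m n r p = 0 := by
  have : detIdeal k m n r ≤ RingHom.ker (phi k m n r) := by
    refine Ideal.span_le.mpr ?_
    rintro _ ⟨f, g, -, -, rfl⟩
    change phi k m n r _ = 0
    rw [AlgHom.map_det]
    have : (phi k m n r).mapMatrix (Matrix.of fun i j => X (f i, g j)) =
        (Matrix.of fun i a => X (Sum.inl (f i, a)) :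
          Matrix (Fin (r + 1)) (Fin r) (MvPolynomial (V m n r) k)) *
        (Matrix.of fun a j => X (Sum.inr (a, g j)) :
          Matrix (Fin r) (Fin (r + 1)) (MvPolynomial (V m n r) k)) := by
      ext1 i j
      simp [phi, entry, Matrix.mul_apply]
    rw [this]
    by_contra hne
    set A := (Matrix.of fun i a => X (Sum.inl (f i, a)) :
          Matrix (Fin (r + 1)) (Fin r) (MvPolynomial (V m n r) k))
    set B := (Matrix.of fun a j => X (Sum.inr (a, g j)) :
          Matrix (Fin r) (Fin (r + 1)) (MvPolynomial (V m n r) k))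
    have h1 : ∀ v, (A * B).mulVec v = 0 → v = 0 := by
      intro v hv
      by_contra h
      exact hne (Matrix.exists_mulVec_eq_zero_iff.mp ⟨v, h, hv⟩)
    have h2 : Function.Injective B.mulVecLin := by
      rw [← LinearMap.ker_eq_bot, LinearMap.ker_eq_bot']
      intro v hv
      apply h1
      rw [← Matrix.mulVec_mulVec]
      rw [Matrix.mulVecLin_apply] at hv
      rw [hv]; simp
    have := LinearMap.finrank_le_finrank_of_injective h2
    simp at this
  exact this hp

lemma mem_detIdeal_iff [CharZero k] (p : MvPolynomial (Fin m × Fin n) k) :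
    p ∈ detIdeal k m n r ↔ phi k m n r p = 0 := by
  refine ⟨detIdeal_le p, fun h => ?_⟩
  have hp : p ∈ (detIdeal k m n r).restrictScalars k ⊔ restrictSupport k {t | Good r t} := by
    rw [p.as_sum]
    refine Submodule.sum_mem _ fun s _ => ?_
    have : monomial s (coeff s p) = coeff s p • monomial s (1 : k) := by
      rw [smul_monomial]; simp
    rw [this]
    exact Submodule.smul_mem _ _ (spanning k r _ s rfl)
  obtain ⟨y, hy, z, hz, rfl⟩ := Submodule.mem_sup.mp hp
  have hy' : y ∈ detIdeal k m n r := hy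
  rw [map_add, detIdeal_le y hy', zero_add] at h
  rw [indep z (fun s hs => (mem_restrictSupport_iff k).mp hz hs) h, add_zero]
  exact hy'

end

section
variable {k : Type*} [Field k] {m n r : ℕ}

/-- top square block of the left generic factor -/
noncomputable def topBlock (k : Type*) [Field k] {m : ℕ} (n : ℕ) {r : ℕ} (h : r ≤ m) :
    Matrix (Fin r) (Fin r) (MvPolynomial (V m n r) k) :=
  Matrix.of fun i a => X (Sum.inl (Fin.castLE h i, a))

lemma topBlock_det (h : r ≤ m) : (topBlock k n h).det ≠ 0 := by
  let ι : Fin r × Fin r → V m n r := fun p => Sum.inl (Fin.castLE h p.1, p.2)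
  have hι : Function.Injective ι := by
    rintro ⟨a, b⟩ ⟨c, d⟩ h'
    simp only [ι, Sum.inl.injEq, Prod.mk.injEq, Fin.castLE_inj] at h'
    exact Prod.ext h'.1 h'.2
  have e : topBlock k n h = (rename ι : _ →ₐ[k] _).mapMatrix
      (Matrix.mvPolynomialX (Fin r) (Fin r) k) := by
    ext1 i j
    simp [topBlock, ι, Matrix.mvPolynomialX]
  rw [e, ← AlgHom.map_det]
  intro h0
  exact Matrix.det_mvPolynomialX_ne_zero (Fin r) k (rename_injective ι hι (by rw [h0, map_zero]))

lemma exists_null (Ω : Finset (Fin m × Fin n)) (j : Fin n)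
    (hcol : (Ω.filter fun p => p.2 = j).card < r) :
    ∃ c : Fin r → MvPolynomial (V m n r) k, c ≠ 0 ∧
      ∀ i, (i, j) ∈ Ω → ∑ a, X (Sum.inl (i, a)) * c a = 0 := by
  classical
  by_contra hcon
  push Not at hcon
  set F := Ω.filter fun p => p.2 = j
  let M : Matrix F (Fin r) (MvPolynomial (V m n r) k) :=
    Matrix.of fun p a => X (Sum.inl (p.1.1, a))
  have h2 : Function.Injective M.mulVecLin := by
    rw [← LinearMap.ker_eq_bot, LinearMap.ker_eq_bot']
    intro c hc
    by_contra h
    obtain ⟨i, hi, hne⟩ := hcon c h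
    apply hne
    have := congrFun hc ⟨(i, j), by simp [F, hi]⟩
    simpa [M, Matrix.mulVec, dotProduct] using this
  have := LinearMap.finrank_le_finrank_of_injective h2
  simp at this
  omega

lemma not_uc [CharZero k] (hrm : r < m) (Ω : Finset (Fin m × Fin n)) (j : Fin n)
    (hcol : (Ω.filter fun p => p.2 = j).card < r) : ¬ UniquelyCompletable k m n r Ω := by
  classical
  intro huc
  obtain ⟨c, hc0, hc⟩ := exists_null (k := k) Ω j hcol
  have hδ : ∃ i : Fin m, ∑ a, X (Sum.inl (i, a)) * c a ≠ 0 := by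
    by_contra hcon
    push Not at hcon
    apply topBlock_det (k := k) (n := n) hrm.le
    rw [← Matrix.exists_mulVec_eq_zero_iff]
    refine ⟨c, hc0, ?_⟩
    ext1 i
    simpa [topBlock, Matrix.mulVec, dotProduct] using hcon (Fin.castLE hrm.le i)
  obtain ⟨i, hi⟩ := hδ
  obtain ⟨a, b, ha, hb, hb0, hab⟩ := huc (i, j)
  rw [Ne, Ideal.Quotient.eq_zero_iff_mem, mem_detIdeal_iff] at hb0
  rw [← map_mul, Ideal.Quotient.eq, mem_detIdeal_iff, map_sub, map_mul, sub_eq_zero] at hab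
  let θ : MvPolynomial (V m n r) k →ₐ[k] MvPolynomial (V m n r) k := aeval fun v =>
    match v with
    | Sum.inl p => X (Sum.inl p)
    | Sum.inr q => X (Sum.inr q) + if q.2 = j then c q.1 else 0
  have hθ : ∀ p : Fin m × Fin n, θ (phi k m n r (X p)) = phi k m n r (X p) +
      if p.2 = j then ∑ a, X (Sum.inl (p.1, a)) * c a else 0 := by
    intro p
    simp only [phi, aeval_X, entry, map_sum, map_mul, θ, mul_add, Finset.sum_add_distrib]
    split_ifs <;> simp
  have hfix : ∀ q ∈ supported k (↑Ω : Set (Fin m × Fin n)),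
      θ (phi k m n r q) = phi k m n r q := by
    intro q hq
    rw [supported_eq_adjoin_X] at hq
    have hle : Algebra.adjoin k (X '' (↑Ω : Set (Fin m × Fin n))) ≤
        AlgHom.equalizer (θ.comp (phi k m n r)) (phi k m n r) := by
      refine Algebra.adjoin_le ?_
      rintro _ ⟨p, hp, rfl⟩
      change θ (phi k m n r (X p)) = phi k m n r (X p)
      rw [hθ]
      split_ifs with h
      · rw [hc p.1 (by rw [← h]; exact hp), add_zero]
      · rw [add_zero]
    exact hle hq
  have h1 := congrArg θ hab
  rw [map_mul, hfix a ha, hfix b hb, hθ, if_pos rfl, mul_add, hab] at h1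
  have h2 : phi k m n r b * ∑ a, X (Sum.inl (i, a)) * c a = 0 := by
    simpa using h1
  exact (mul_ne_zero hb0 hi) h2

lemma card_le_of_adjoin {K : Type*} [Field K] [Algebra k K] {ι : Type} [Fintype ι]
    (x : ι → K) (hx : AlgebraicIndependent k x) (T : Finset K)
    (hT : ∀ i, x i ∈ Algebra.adjoin k (T : Set K)) : Fintype.card ι ≤ T.card := by
  classical
  set A := Algebra.adjoin k (T : Set K)
  let y : ι → A := fun i => ⟨x i, hT i⟩
  have hy : AlgebraicIndependent k y :=
    (A.val.algebraicIndependent_iff Subtype.val_injective).mp hx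
  let s : Set A := Subtype.val ⁻¹' (T : Set K)
  have htop : Algebra.adjoin k s = ⊤ := Algebra.adjoin_adjoin_coe_preimage
  have halg : Algebra.IsAlgebraic (Algebra.adjoin k s) A := by
    refine ⟨fun z => ?_⟩
    exact isAlgebraic_algebraMap (⟨z, by rw [htop]; trivial⟩ : Algebra.adjoin k s)
  have h1 := Algebra.IsAlgebraic.trdeg_le_cardinalMk k s
  have h2 := hy.lift_cardinalMk_le_trdeg
  have hs : Cardinal.mk s ≤ T.card := by
    have : Function.Injective (fun z : s => (⟨z.1.1, z.2⟩ : T)) := by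
      intro a b h
      exact Subtype.ext (Subtype.ext (congrArg (fun z : T => z.1) h))
    have := Cardinal.mk_le_of_injective this
    simpa using this
  have h3 := h2.trans (Cardinal.lift_le.mpr (h1.trans hs))
  simpa using h3

lemma card_lt [CharZero k] (hrm : r < m) (hrn : r < n) (Ω : Finset (Fin m × Fin n)) (j : Fin n)
    (hcol : (Ω.filter fun p => p.2 = j).card < r) (S : Finset (Fin m × Fin n)) (hS : S ⊆ Ω)
    (hind : AlgebraicIndependent k
        (fun p : S => Ideal.Quotient.mk (detIdeal k m n r) (X p.val))) :
    S.card < r * (m + n - r) := by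
  classical
  let P := MvPolynomial (V m n r) k
  let K := FractionRing P
  let ψ : (MvPolynomial (Fin m × Fin n) k ⧸ detIdeal k m n r) →ₐ[k] P :=
    Ideal.Quotient.liftₐ _ (phi k m n r) (fun a ha => detIdeal_le a ha)
  have hψ : Function.Injective ψ := by
    rw [injective_iff_map_eq_zero]
    intro a ha
    obtain ⟨a, rfl⟩ := Ideal.Quotient.mk_surjective a
    rw [Ideal.Quotient.eq_zero_iff_mem, mem_detIdeal_iff]
    exact ha
  let al : P →ₐ[k] K := IsScalarTower.toAlgHom k P K
  have hal : Function.Injective al := IsFractionRing.injective P K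
  have hind2 : AlgebraicIndependent k (fun p : S => al (entry k m n r p.val)) := by
    have h := (hind.map' hψ).map' hal
    convert h using 2 with p
    change _ = al (phi k m n r (X p.val))
    rw [phi, aeval_X]
  let xm : Matrix (Fin m) (Fin r) K := Matrix.of fun i a => al (X (Sum.inl (i, a)))
  let ym : Matrix (Fin r) (Fin n) K := Matrix.of fun a j => al (X (Sum.inr (a, j)))
  let x1 : Matrix (Fin r) (Fin r) K := al.mapMatrix (topBlock k n hrm.le)
  have hx1 : IsUnit x1.det := by
    rw [isUnit_iff_ne_zero, ← AlgHom.map_det]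
    intro h
    exact topBlock_det (k := k) (n := n) hrm.le (hal (by rw [h, map_zero]))
  have hent : ∀ p, al (entry k m n r p) = (xm * ym) p.1 p.2 := by
    intro p
    simp [entry, xm, ym, Matrix.mul_apply]
  let x' := xm * x1⁻¹
  let y' := x1 * ym
  have hxy : xm * ym = x' * y' := by
    simp only [x', y']
    rw [Matrix.mul_assoc, ← Matrix.mul_assoc x1⁻¹, Matrix.nonsing_inv_mul _ hx1, Matrix.one_mul]
  have htop : ∀ (i : Fin r) a, x' (Fin.castLE hrm.le i) a = (1 : Matrix (Fin r) (Fin r) K) i a := by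
    intro i a
    rw [← Matrix.mul_nonsing_inv _ hx1]
    rfl
  let T1 : Finset K := Finset.univ.image fun q : Fin (m - r) × Fin r =>
    x' ⟨r + q.1, by omega⟩ q.2
  let T2 : Finset K := (Finset.univ ×ˢ Finset.univ.erase j).image fun q : Fin r × Fin n => y' q.1 q.2
  let T3 : Finset K := (Ω.filter fun p => p.2 = j).image fun p => al (entry k m n r p)
  have hT1 : T1.card ≤ (m - r) * r := by
    refine Finset.card_image_le.trans ?_
    simp
  have hT2 : T2.card ≤ r * (n - 1) := by
    refine Finset.card_image_le.trans ?_
    rw [Finset.card_product, Finset.card_erase_of_mem (Finset.mem_univ j)]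
    simp
  have hT3 : T3.card < r := Finset.card_image_le.trans_lt hcol
  have hsub : ∀ p : S, al (entry k m n r p.val) ∈
      Algebra.adjoin k ((T1 ∪ T2 ∪ T3 : Finset K) : Set K) := by
    rintro ⟨⟨i, j'⟩, hp⟩
    by_cases hj : j' = j
    · refine Algebra.subset_adjoin ?_
      rw [Finset.mem_coe]
      refine Finset.mem_union_right _ (Finset.mem_image_of_mem _ ?_)
      exact Finset.mem_filter.mpr ⟨hS hp, hj⟩
    · rw [hent, hxy, Matrix.mul_apply]
      refine Subalgebra.sum_mem _ fun a _ => Subalgebra.mul_mem _ ?_ ?_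
      · by_cases hi : (i : ℕ) < r
        · have : i = Fin.castLE hrm.le ⟨i, hi⟩ := by ext; rfl
          simp only
          rw [this, htop, Matrix.one_apply]
          split_ifs
          · exact Subalgebra.one_mem _
          · exact Subalgebra.zero_mem _
        · refine Algebra.subset_adjoin ?_
          rw [Finset.mem_coe]
          refine Finset.mem_union_left _ (Finset.mem_union_left _ ?_)
          refine Finset.mem_image.mpr ⟨(⟨i - r, by omega⟩, a), Finset.mem_univ _, ?_⟩
          congr 1
          ext
          simp only
          omega
      · refine Algebra.subset_adjoin ?_
        rw [Finset.mem_coe]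
        refine Finset.mem_union_left _ (Finset.mem_union_right _ ?_)
        exact Finset.mem_image.mpr ⟨(a, j'), by simp [hj], rfl⟩
  have hcard := card_le_of_adjoin _ hind2 _ hsub
  have hu : (T1 ∪ T2 ∪ T3).card ≤ T1.card + T2.card + T3.card :=
    (Finset.card_union_le _ _).trans (Nat.add_le_add_right (Finset.card_union_le _ _) _)
  rw [Fintype.card_coe] at hcard
  obtain ⟨u, rfl⟩ := Nat.exists_eq_add_of_lt hrm
  obtain ⟨v, rfl⟩ := Nat.exists_eq_add_of_lt hrn
  have e1 : r + u + 1 - r = u + 1 := by omega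
  have e2 : r + v + 1 - 1 = r + v := by omega
  have e3 : r + u + 1 + (r + v + 1) - r = (u + 1) + (r + v) + 1 := by omega
  rw [e1] at hT1
  rw [e2] at hT2
  rw [e3]
  nlinarith

end

end SmallCol

/-- If some column of `Ω` has fewer than `r` observed entries, then `Ω` is not uniquely
completable at rank `r`; in fact the transcendence degree of `k(Z̄_Ω)` over `k` is strictly
less than `r(m+n-r)`: every algebraically independent subset of the residues of `Z_Ω` has
cardinality `< r(m+n-r)`. -/
theorem not_uniquelyCompletable_of_small_column {k : Type*} [Field k] [CharZero k]
    {m n r : ℕ} (hrm : r < m) (hrn : r < n)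
    (Ω : Finset (Fin m × Fin n)) (j : Fin n)
    (hcol : (Ω.filter fun p => p.2 = j).card < r) :
    ¬ UniquelyCompletable k m n r Ω ∧
    ∀ S : Finset (Fin m × Fin n), S ⊆ Ω →
      AlgebraicIndependent k
        (fun p : S => Ideal.Quotient.mk (detIdeal k m n r) (X p.val)) →
      S.card < r * (m + n - r) := by
  exact ⟨SmallCol.not_uc hrm Ω j hcol, fun S hS h => SmallCol.card_lt hrm hrn Ω j hcol S hS h⟩
end

section
/- Let k have characteristic zero and Z an m × n matrix of variables. If a subset Ω ⊆ [m] × [n] is uniquely completable at rank r (i.e. k(Z̄_Ω) = k(Z̄) where Z̄ denotes residues modulo I_{r+1}(Z)), then for every r' with 1 ≤ r' < r, Ω is uniquely completable at rank r' (i.e. the analogous field equality holds modulo I_{r'+1}(Z)). -/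
open MvPolynomial

namespace DetSFT

/-- Dual Dilworth (Mirsky): a finite set without `R`-chains of length `r+1` is a union of `r` antichains. -/
lemma mirsky {α : Type*} (R : α → α → Prop) (htr : ∀ a b c, R a b → R b c → R a c) :
    ∀ (r : ℕ) (s : Set α),
      (¬ ∃ f : Fin (r + 1) → α, (∀ a, f a ∈ s) ∧ ∀ a b, a < b → R (f a) (f b)) →
      ∃ c : α → ℕ, (∀ x ∈ s, c x < r) ∧ ∀ x ∈ s, ∀ y ∈ s, c x = c y → ¬ R x y := by
  classical
  intro r
  induction r with
  | zero =>
    intro s hs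
    have : ∀ x, x ∉ s := fun x hx => hs ⟨fun _ => x, fun _ => hx, fun a b hab => by
      exfalso; have h1 := a.2; have h2 := b.2; have h3 : a.val < b.val := hab; omega⟩
    exact ⟨fun _ => 0, fun x hx => absurd hx (this x), fun x hx => absurd hx (this x)⟩
  | succ r ih =>
    intro s hs
    obtain ⟨c, hc1, hc2⟩ := ih {x | x ∈ s ∧ ∃ y ∈ s, R y x} (by
      rintro ⟨f, hf1, hf2⟩
      obtain ⟨y, hy, hyf⟩ := (hf1 0).2
      refine hs ⟨Fin.cons y f, ?_, ?_⟩
      · intro a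
        refine Fin.cases ?_ (fun a => ?_) a
        · simpa using hy
        · simpa using (hf1 a).1
      · intro a b
        refine Fin.cases ?_ (fun a => ?_) a
        · refine Fin.cases ?_ (fun b => ?_) b
          · intro h; exact absurd h (lt_irrefl _)
          · intro _
            simp only [Fin.cons_zero, Fin.cons_succ]
            rcases eq_or_ne b 0 with rfl | hb
            · exact hyf
            · exact htr _ _ _ hyf (hf2 _ _ (Fin.pos_of_ne_zero hb))
        · refine Fin.cases ?_ (fun b => ?_) b
          · intro h; exact absurd h (Fin.not_lt_zero _)
          · intro h
            simp only [Fin.cons_succ]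
            exact hf2 _ _ (Fin.succ_lt_succ_iff.1 h))
    refine ⟨fun x => if ∃ y ∈ s, R y x then c x else r, ?_, ?_⟩
    · intro x hx
      dsimp only
      split_ifs with h
      · exact Nat.lt_succ_of_lt (hc1 x ⟨hx, h⟩)
      · exact Nat.lt_succ_self r
    · intro x hx y hy hxy hR
      dsimp only at hxy
      have hy' : ∃ z ∈ s, R z y := ⟨x, hx, hR⟩
      rw [if_pos hy'] at hxy
      split_ifs at hxy with h
      · exact hc2 x ⟨hx, h⟩ y ⟨hy, hy'⟩ hxy hR
      · have := hc1 y ⟨hy, hy'⟩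
        omega

/-- cumulative sums -/
def cum {m n : ℕ} (N : Fin m × Fin n → ℕ) (a : Fin m) (b : Fin n) : ℕ :=
  ∑ i, ∑ j, if a ≤ i ∧ b ≤ j then N (i, j) else 0

/-- weight of a monomial -/
def wt {m n : ℕ} (M : Fin m × Fin n → ℕ) : ℕ :=
  ∑ p, M p * ((p.1.val + 1) * (p.2.val + 1))

lemma sum_cum {m n : ℕ} (N : Fin m × Fin n → ℕ) : ∑ a, ∑ b, cum N a b = wt N := by
  have h1 : ∀ a b, cum N a b =
      ∑ p : Fin m × Fin n, N p * ((if a ≤ p.1 then 1 else 0) * (if b ≤ p.2 then 1 else 0)) := by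
    intro a b
    rw [Fintype.sum_prod_type]
    unfold cum
    refine Finset.sum_congr rfl fun i _ => Finset.sum_congr rfl fun j _ => ?_
    by_cases ha : a ≤ i <;> by_cases hb : b ≤ j <;> simp [ha, hb]
  simp_rw [h1]
  have h2 : ∀ a : Fin m, (∑ b : Fin n, ∑ p : Fin m × Fin n,
      N p * ((if a ≤ p.1 then 1 else 0) * (if b ≤ p.2 then 1 else 0))) =
      ∑ p : Fin m × Fin n, N p * ((if a ≤ p.1 then 1 else 0) * (p.2.val + 1)) := by
    intro a
    rw [Finset.sum_comm]
    refine Finset.sum_congr rfl fun p _ => ?_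
    rw [← Finset.mul_sum, ← Finset.mul_sum]
    congr 2
    rw [← Finset.card_filter]
    have : (Finset.univ.filter fun b : Fin n => b ≤ p.2) = Finset.Iic p.2 := by ext; simp
    rw [this, Fin.card_Iic]
  simp_rw [h2]
  rw [Finset.sum_comm]
  unfold wt
  refine Finset.sum_congr rfl fun p _ => ?_
  rw [← Finset.mul_sum, ← Finset.sum_mul]
  congr 2
  rw [← Finset.card_filter]
  have : (Finset.univ.filter fun b : Fin m => b ≤ p.1) = Finset.Iic p.1 := by ext; simp
  rw [this, Fin.card_Iic]

lemma cum_le {m n : ℕ} (N N' : Fin m × Fin n → ℕ)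
    (hrow : ∀ i, ∑ j, N' (i, j) = ∑ j, N (i, j)) (hcol : ∀ j, ∑ i, N' (i, j) = ∑ i, N (i, j))
    (hN : ∀ p q, N p ≠ 0 → N q ≠ 0 → ¬ (p.1 < q.1 ∧ q.2 < p.2)) (a : Fin m) (b : Fin n) :
    cum N' a b ≤ cum N a b := by
  have hR : cum N' a b ≤ ∑ i, if a ≤ i then ∑ j, N (i, j) else 0 := by
    unfold cum
    refine Finset.sum_le_sum fun i _ => ?_
    by_cases ha : a ≤ i
    · simp only [ha, true_and, if_true]
      rw [← hrow]
      refine Finset.sum_le_sum fun j _ => ?_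
      split_ifs <;> simp
    · simp [ha]
  have hC : cum N' a b ≤ ∑ j, if b ≤ j then ∑ i, N (i, j) else 0 := by
    unfold cum
    rw [Finset.sum_comm]
    refine Finset.sum_le_sum fun i _ => ?_
    by_cases ha : b ≤ i
    · simp only [ha, and_true, if_true]
      rw [← hcol]
      refine Finset.sum_le_sum fun j _ => ?_
      split_ifs <;> simp
    · simp [ha]
  by_cases h : ∃ i j, a ≤ i ∧ j < b ∧ N (i, j) ≠ 0
  · refine hC.trans (le_of_eq ?_)
    obtain ⟨i, j, hi, hj, hij⟩ := h
    unfold cum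
    rw [Finset.sum_comm]
    refine Finset.sum_congr rfl fun j' _ => ?_
    by_cases hb : b ≤ j'
    · simp only [hb, and_true, if_true]
      refine Finset.sum_congr rfl fun i' _ => ?_
      split_ifs with hi'
      · rfl
      · by_contra h0
        exact hN (i', j') (i, j) h0 hij ⟨lt_of_lt_of_le (not_le.1 hi') hi, lt_of_lt_of_le hj hb⟩
    · simp [hb]
  · push Not at h
    refine hR.trans (le_of_eq ?_)
    unfold cum
    refine Finset.sum_congr rfl fun i _ => ?_
    by_cases ha : a ≤ i
    · simp only [ha, true_and, if_true]
      refine Finset.sum_congr rfl fun j _ => ?_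
      split_ifs with hj
      · rfl
      · exact h i j ha (not_le.1 hj)
    · simp [ha]

lemma eq_of_cum_eq {m n : ℕ} (N N' : Fin m × Fin n → ℕ)
    (h : ∀ a b, cum N' a b = cum N a b) : N' = N := by
  classical
  by_contra hne
  have hnon : (Finset.univ.filter fun p => N' p ≠ N p).Nonempty := by
    obtain ⟨p, hp⟩ := Function.ne_iff.1 hne
    exact ⟨p, by simpa using hp⟩
  obtain ⟨p, hp⟩ := Finset.exists_maximal hnon
  have hp1 : N' p ≠ N p := by simpa using hp.1
  have hp2 : ∀ q, p ≤ q → q ≠ p → N' q = N q := by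
    intro q hq hqp
    by_contra hc
    exact hqp (le_antisymm (hp.2 (by simpa using hc) hq) hq)
  have hh := h p.1 p.2
  have key : ∀ K : Fin m × Fin n → ℕ, cum K p.1 p.2 =
      K p + ∑ q ∈ Finset.univ.erase p, if p ≤ q then K q else 0 := by
    intro K
    have : cum K p.1 p.2 = ∑ q, if p ≤ q then K q else 0 := by
      rw [Fintype.sum_prod_type]; rfl
    rw [this, ← Finset.add_sum_erase _ _ (Finset.mem_univ p)]
    simp
  rw [key, key] at hh
  have : (∑ q ∈ Finset.univ.erase p, if p ≤ q then N' q else 0) =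
      ∑ q ∈ Finset.univ.erase p, if p ≤ q then N q else 0 := by
    refine Finset.sum_congr rfl fun q hq => ?_
    split_ifs with hpq
    · exact hp2 q hpq (Finset.ne_of_mem_erase hq)
    · rfl
  omega

/-- Rearrangement: coloured version. -/
lemma rearr {m n r : ℕ} (N N' : Fin m × Fin n → Fin r → ℕ)
    (hrow : ∀ c i, ∑ j, N' (i, j) c = ∑ j, N (i, j) c)
    (hcol : ∀ c j, ∑ i, N' (i, j) c = ∑ i, N (i, j) c)
    (hN : ∀ c p q, N p c ≠ 0 → N q c ≠ 0 → ¬ (p.1 < q.1 ∧ q.2 < p.2))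
    (hwt : wt (fun p => ∑ c, N p c) ≤ wt (fun p => ∑ c, N' p c)) : N' = N := by
  have hsplit : ∀ K : Fin m × Fin n → Fin r → ℕ,
      wt (fun p => ∑ c, K p c) = ∑ c, ∑ a, ∑ b, cum (fun p => K p c) a b := by
    intro K
    simp_rw [sum_cum]
    unfold wt
    rw [Finset.sum_comm]
    simp_rw [Finset.sum_mul]
  rw [hsplit, hsplit] at hwt
  have hle : ∀ c a b, cum (fun p => N' p c) a b ≤ cum (fun p => N p c) a b := fun c a b =>
    cum_le (fun p => N p c) (fun p => N' p c) (hrow c) (hcol c) (hN c) a b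
  have heq : ∀ c a b, cum (fun p => N' p c) a b = cum (fun p => N p c) a b := by
    intro c a b
    by_contra hne
    refine absurd hwt (not_le.2 ?_)
    refine Finset.sum_lt_sum (fun c _ => Finset.sum_le_sum fun a _ => Finset.sum_le_sum fun b _ =>
      hle c a b) ⟨c, Finset.mem_univ _, ?_⟩
    refine Finset.sum_lt_sum (fun a _ => Finset.sum_le_sum fun b _ =>
      hle c a b) ⟨a, Finset.mem_univ _, ?_⟩
    exact Finset.sum_lt_sum (fun b _ => hle c a b)
      ⟨b, Finset.mem_univ _, lt_of_le_of_ne (hle c a b) hne⟩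
  funext p c
  exact congrFun (eq_of_cum_eq (fun p => N p c) (fun p => N' p c) (heq c)) p

/-- exponent vector of the image monomial -/
noncomputable def pim {m n r : ℕ} (N : Fin m × Fin n → Fin r → ℕ) :
    ((Fin m × Fin r) ⊕ (Fin r × Fin n)) →₀ ℕ :=
  Finsupp.equivFunOnFinite.symm
    (Sum.elim (fun ic => ∑ j, N (ic.1, j) ic.2) (fun cj => ∑ i, N (i, cj.2) cj.1))

/-- the generic rank r parametrisation -/
noncomputable def phi (k : Type*) [Field k] (m n r : ℕ) :
    MvPolynomial (Fin m × Fin n) k →ₐ[k]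
      MvPolynomial ((Fin m × Fin r) ⊕ (Fin r × Fin n)) k :=
  aeval (fun p => ∑ c, X (Sum.inl (p.1, c)) * X (Sum.inr (c, p.2)))

lemma prod_eq_pim {k : Type*} [Field k] {m n r : ℕ} (N : Fin m × Fin n → Fin r → ℕ) :
    (∏ p : Fin m × Fin n, ∏ c : Fin r,
      ((X (Sum.inl (p.1, c)) * X (Sum.inr (c, p.2)) :
        MvPolynomial ((Fin m × Fin r) ⊕ (Fin r × Fin n)) k)) ^ N p c) = monomial (pim N) 1 := by
  rw [monomial_eq, Finsupp.prod_fintype _ _ (by simp), Fintype.prod_sum_type,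
    Fintype.prod_prod_type, Fintype.prod_prod_type, Fintype.prod_prod_type]
  simp only [mul_pow, Finset.prod_mul_distrib, C_1, one_mul, pim,
    Finsupp.equivFunOnFinite_symm_apply_apply, Sum.elim_inl, Sum.elim_inr, ← Finset.prod_pow_eq_pow_sum]
  congr 1
  · exact Finset.prod_congr rfl fun i _ => Finset.prod_comm
  · rw [Finset.prod_comm]
    simp_rw [Finset.prod_comm (s := (Finset.univ : Finset (Fin m)))]
    rw [Finset.prod_comm]

lemma coeff_phi {k : Type*} [Field k] {m n r : ℕ} (M : Fin m × Fin n →₀ ℕ)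
    (μ : ((Fin m × Fin r) ⊕ (Fin r × Fin n)) →₀ ℕ) :
    coeff μ (phi k m n r (monomial M 1)) =
      ((∑ N ∈ Fintype.piFinset (fun p => Finset.piAntidiag (Finset.univ : Finset (Fin r)) (M p)),
        if pim N = μ then ∏ p, Nat.multinomial Finset.univ (N p) else 0 : ℕ) : k) := by
  classical
  have : phi k m n r (monomial M 1) =
      ∑ N ∈ Fintype.piFinset (fun p => Finset.piAntidiag (Finset.univ : Finset (Fin r)) (M p)),
        monomial (pim N) ((∏ p, Nat.multinomial Finset.univ (N p) : ℕ) : k) := by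
    rw [phi, aeval_monomial, Finsupp.prod_fintype _ _ (by simp)]
    simp_rw [Finset.sum_pow_eq_sum_piAntidiag]
    rw [Finset.prod_univ_sum, map_one, one_mul]
    refine Finset.sum_congr rfl fun N _ => ?_
    rw [Finset.prod_mul_distrib, prod_eq_pim, ← Nat.cast_prod, ← map_natCast C, C_mul_monomial,
      mul_one]
  rw [this, coeff_sum, Nat.cast_sum]
  refine Finset.sum_congr rfl fun N _ => ?_
  rw [coeff_monomial]
  split_ifs <;> simp

/-- monomials not containing an antidiagonal of length `r+1` -/
def Good {m n : ℕ} (r : ℕ) (M : Fin m × Fin n →₀ ℕ) : Prop :=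
  ¬ ∃ f : Fin (r + 1) → Fin m × Fin n, (∀ a, f a ∈ {p | M p ≠ 0}) ∧
    ∀ a b, a < b → ((f a).1 < (f b).1 ∧ (f b).2 < (f a).2)

lemma good_zero {k : Type*} [Field k] [CharZero k] {m n r : ℕ} (hr : 0 < r)
    (g : MvPolynomial (Fin m × Fin n) k) (hg : ∀ M ∈ g.support, Good r M)
    (h0 : phi k m n r g = 0) : g = 0 := by
  classical
  by_contra hne
  obtain ⟨M, hM, hmin⟩ := Finset.exists_min_image g.support (fun M => wt M)
    (support_nonempty.2 hne)
  obtain ⟨c, hc1, hc2⟩ := mirsky (fun p q : Fin m × Fin n => p.1 < q.1 ∧ q.2 < p.2)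
    (fun _ _ _ h1 h2 => ⟨h1.1.trans h2.1, h2.2.trans h1.2⟩) r _ (hg M hM)
  let N : Fin m × Fin n → Fin r → ℕ := fun p d => if c p = d.val then M p else 0
  have hNM : ∀ p, ∑ d, N p d = M p := by
    intro p
    by_cases hp : M p = 0
    · simp [N, hp]
    · have hlt := hc1 p hp
      rw [Finset.sum_eq_single (⟨c p, hlt⟩ : Fin r)]
      · simp [N]
      · intro d _ hd
        simp only [N]
        rw [if_neg]
        intro h; exact hd (Fin.ext h.symm)
      · simp
  have hNchain : ∀ d p q, N p d ≠ 0 → N q d ≠ 0 → ¬ (p.1 < q.1 ∧ q.2 < p.2) := by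
    intro d p q hp hq
    simp only [N, ne_eq, ite_eq_right_iff, not_forall] at hp hq
    obtain ⟨hp1, hp2⟩ := hp
    obtain ⟨hq1, hq2⟩ := hq
    exact hc2 p hp2 q hq2 (hp1.trans hq1.symm)
  have hco : coeff (pim N) (phi k m n r g) = 0 := by rw [h0, coeff_zero]
  have hgsum : phi k m n r g =
      ∑ M' ∈ g.support, C (coeff M' g) * phi k m n r (monomial M' 1) := by
    conv_lhs => rw [g.as_sum]
    rw [map_sum]
    refine Finset.sum_congr rfl fun M' _ => ?_
    rw [← mul_one (coeff M' g), ← C_mul_monomial, map_mul, mul_one]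
    congr 1
    exact (phi k m n r).commutes _
  rw [hgsum, coeff_sum, Finset.sum_eq_single M] at hco
  · rw [coeff_C_mul, mul_eq_zero] at hco
    rcases hco with h | h
    · exact (mem_support_iff.1 hM) h
    · rw [coeff_phi, Nat.cast_eq_zero, Finset.sum_eq_zero_iff] at h
      have := h N (by
        rw [Fintype.mem_piFinset]
        intro p
        simp [Finset.mem_piAntidiag, hNM p])
      rw [if_pos rfl, Finset.prod_eq_zero_iff] at this
      obtain ⟨p, _, hp⟩ := this
      exact (Nat.multinomial_pos _ _).ne' hp
  · intro M' hM' hne'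
    rw [coeff_C_mul, coeff_phi, Finset.sum_eq_zero, Nat.cast_zero, mul_zero]
    intro N' hN'
    rw [if_neg]
    intro hpi
    rw [Fintype.mem_piFinset] at hN'
    have hN'M : ∀ p, ∑ d, N' p d = M' p := fun p => (Finset.mem_piAntidiag.1 (hN' p)).1
    have hx := fun s => DFunLike.congr_fun hpi s
    have : N' = N := by
      refine rearr N N' (fun c i => ?_) (fun c j => ?_) hNchain ?_
      · exact hx (Sum.inl (i, c))
      · exact hx (Sum.inr (c, j))
      · simp_rw [hNM, hN'M]
        exact hmin M' hM'
    apply hne'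
    ext p
    rw [← hN'M, ← hNM, this]
  · intro h; exact absurd hM h

lemma wt_add {m n : ℕ} (M M' : Fin m × Fin n →₀ ℕ) : wt ⇑(M + M') = wt ⇑M + wt ⇑M' := by
  simp [wt, add_mul, Finset.sum_add_distrib]

lemma wt_sum_single {m n : ℕ} {ι : Type*} (s : Finset ι) (f : ι → Fin m × Fin n) :
    wt ⇑(∑ a ∈ s, Finsupp.single (f a) 1) =
      ∑ a ∈ s, ((f a).1.val + 1) * ((f a).2.val + 1) := by
  classical
  induction s using Finset.induction_on with
  | empty => simp [wt]
  | insert a s ha ih =>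
    rw [Finset.sum_insert ha, Finset.sum_insert ha, wt_add, ih]
    congr 1
    simp [wt, Finsupp.single_apply]

lemma wt_le {m n : ℕ} (M : Fin m × Fin n →₀ ℕ) : wt ⇑M ≤ M.degree * (m * n) := by
  rw [Finsupp.degree_eq_sum, Finset.sum_mul]
  unfold wt
  refine Finset.sum_le_sum fun p _ => ?_
  gcongr
  · exact p.1.2
  · exact p.2.2

/-- rearrangement for an antidiagonal -/
lemma antidiag_lt {t m n : ℕ} (f : Fin t → Fin m) (g : Fin t → Fin n) (hf : StrictMono f)
    (hg : StrictAnti g) (σ : Equiv.Perm (Fin t)) (hσ : σ ≠ 1) :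
    ∑ a, ((f a).val + 1) * ((g a).val + 1) < ∑ a, ((f (σ a)).val + 1) * ((g a).val + 1) := by
  have hav : Antivary (fun a => (f a).val + 1) (fun a => (g a).val + 1) := by
    intro a b hab
    have : g a < g b := by simpa using hab
    have := hg.lt_iff_gt.1 this
    have := hf this
    have : (f b).val < (f a).val := this
    show (f b).val + 1 ≤ (f a).val + 1
    omega
  refine hav.sum_mul_lt_sum_comp_perm_mul_iff.2 ?_
  intro h
  apply hσ
  have hmono : StrictMono σ := by
    intro a b hab
    have h1 : g b < g a := hg hab
    have h2 : (f (σ a)).val + 1 ≤ (f (σ b)).val + 1 := h (i := b) (j := a) (by simpa using h1)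
    have h3 : f (σ a) ≤ f (σ b) := by
      show (f (σ a)).val ≤ (f (σ b)).val
      omega
    exact lt_of_le_of_ne (hf.le_iff_le.1 h3) (fun h => hab.ne (σ.injective h))
  ext a
  have := Subsingleton.elim (hmono.orderIsoOfSurjective σ σ.surjective) (OrderIso.refl _)
  have h2 := DFunLike.congr_fun this a
  simpa using congrArg Fin.val h2

lemma span_good {k : Type*} [Field k] {m n r : ℕ} :
    ∀ (d : ℕ) (M : Fin m × Fin n →₀ ℕ), M.degree * (m * n) - wt ⇑M = d →
      ∃ g : MvPolynomial (Fin m × Fin n) k, (∀ M' ∈ g.support, Good r M') ∧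
        monomial M 1 - g ∈ detIdeal k m n r := by
  classical
  intro d
  induction d using Nat.strong_induction_on with
  | _ d ih =>
  intro M hd
  by_cases hM : Good r M
  · refine ⟨monomial M 1, fun M' hM' => ?_, by simp⟩
    have := Finset.mem_of_subset support_monomial_subset hM'
    rw [Finset.mem_singleton] at this
    rwa [this]
  · unfold Good at hM
    push Not at hM
    obtain ⟨e, he1, he2⟩ := hM
    set f : Fin (r + 1) → Fin m := fun a => (e a).1 with hf
    set g : Fin (r + 1) → Fin n := fun a => (e a).2 with hg
    have hfm : StrictMono f := fun a b hab => (he2 a b hab).1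
    have hga : StrictAnti g := fun a b hab => (he2 a b hab).2
    have hle : (∑ a, Finsupp.single (e a) 1) ≤ M := by
      intro p
      rw [Finsupp.finsetSum_apply]
      by_cases hp : ∃ a, e a = p
      · obtain ⟨a, rfl⟩ := hp
        rw [Finset.sum_eq_single a]
        · simpa [Nat.one_le_iff_ne_zero] using he1 a
        · intro b _ hb
          rw [Finsupp.single_apply, if_neg]
          intro h
          exact hb (hfm.injective (congrArg Prod.fst h))
        · simp
      · rw [Finset.sum_eq_zero]
        · exact Nat.zero_le _
        · intro a _
          rw [Finsupp.single_apply, if_neg]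
          intro h; exact hp ⟨a, h⟩
    obtain ⟨M0, hM0⟩ := exists_add_of_le hle
    let Mσ : Equiv.Perm (Fin (r + 1)) → (Fin m × Fin n →₀ ℕ) := fun σ =>
      (∑ a, Finsupp.single (f (σ a), g a) 1) + M0
    have hM1 : Mσ 1 = M := by rw [hM0]; rfl
    have hmon : ∀ σ, (monomial (Mσ σ) 1 : MvPolynomial (Fin m × Fin n) k) =
        (∏ a, X (f (σ a), g a)) * monomial M0 1 := by
      intro σ
      have : (∏ a, X (f (σ a), g a) : MvPolynomial (Fin m × Fin n) k) =
          monomial (∑ a, Finsupp.single (f (σ a), g a) 1) 1 := by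
        rw [monomial_sum_one]; rfl
      rw [this, monomial_mul, mul_one]
    have hdeg : ∀ σ, (Mσ σ).degree = M.degree := by
      intro σ
      rw [← hM1]
      simp [Mσ, map_sum]
    have hwt : ∀ σ, σ ≠ 1 → wt ⇑M < wt ⇑(Mσ σ) := by
      intro σ hσ
      rw [← hM1]
      simp only [Mσ, wt_add, wt_sum_single]
      exact Nat.add_lt_add_right (antidiag_lt f g hfm hga σ hσ) _
    have hex : ∀ σ, ∃ q : MvPolynomial (Fin m × Fin n) k, σ ≠ 1 → (∀ M' ∈ q.support, Good r M') ∧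
        monomial (Mσ σ) 1 - q ∈ detIdeal k m n r := by
      intro σ
      by_cases hσ : σ = 1
      · exact ⟨0, fun h => absurd hσ h⟩
      · obtain ⟨q, hq⟩ := ih ((Mσ σ).degree * (m * n) - wt ⇑(Mσ σ)) (by
          have h1 := wt_le (Mσ σ)
          have h2 := hwt σ hσ
          rw [hdeg] at h1 ⊢
          omega) (Mσ σ) rfl
        exact ⟨q, fun _ => hq⟩
    choose q hq using hex
    have hdet : (Matrix.of fun i j => (X (f i, g j) : MvPolynomial (Fin m × Fin n) k)).det ∈
        detIdeal k m n r :=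
      Ideal.subset_span ⟨f, g, hfm.injective, hga.injective, rfl⟩
    have hdet' := Ideal.mul_mem_right (monomial M0 1) _ hdet
    rw [Matrix.det_apply, Finset.sum_mul, ← Finset.add_sum_erase _ _ (Finset.mem_univ 1)] at hdet'
    refine ⟨- ∑ σ ∈ Finset.univ.erase 1, Equiv.Perm.sign σ • q σ, ?_, ?_⟩
    · intro M' hM'
      rw [support_neg] at hM'
      have := Finset.mem_of_subset support_sum hM'
      rw [Finset.mem_biUnion] at this
      obtain ⟨σ, hσ, h⟩ := this
      refine (hq σ (Finset.ne_of_mem_erase hσ)).1 M' ?_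
      rcases Int.units_eq_one_or (Equiv.Perm.sign σ) with h1 | h1 <;> rw [h1] at h
      · simpa using h
      · simpa [Units.smul_def, support_neg] using h
    · have h2 : ∑ σ ∈ Finset.univ.erase (1 : Equiv.Perm (Fin (r + 1))),
          Equiv.Perm.sign σ • (monomial (Mσ σ) 1 - q σ) ∈ detIdeal k m n r := by
        refine Ideal.sum_mem _ fun σ hσ => ?_
        have := (hq σ (Finset.ne_of_mem_erase hσ)).2
        rcases Int.units_eq_one_or (Equiv.Perm.sign σ) with h1 | h1 <;> rw [h1]
        · simpa using this
        · simpa [Units.smul_def] using (detIdeal k m n r).neg_mem this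
      have h3 := (detIdeal k m n r).sub_mem hdet' h2
      convert h3 using 1
      have hone : (Equiv.Perm.sign (1 : Equiv.Perm (Fin (r + 1))) •
          ∏ i, (Matrix.of fun i j => (X (f i, g j) : MvPolynomial (Fin m × Fin n) k))
            ((1 : Equiv.Perm (Fin (r + 1))) i) i) * monomial M0 1 = monomial M 1 := by
        rw [← hM1, hmon]
        simp
      rw [hone, sub_neg_eq_add, add_sub_assoc, ← Finset.sum_sub_distrib]
      congr 1
      refine Finset.sum_congr rfl fun σ _ => ?_
      rw [smul_sub, hmon, smul_mul_assoc]
      simp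

lemma exists_good {k : Type*} [Field k] {m n r : ℕ} (f : MvPolynomial (Fin m × Fin n) k) :
    ∃ g : MvPolynomial (Fin m × Fin n) k, (∀ M' ∈ g.support, Good r M') ∧
        f - g ∈ detIdeal k m n r := by
  classical
  induction f using MvPolynomial.induction_on' with
  | monomial M a =>
    obtain ⟨g, hg1, hg2⟩ := span_good (k := k) (r := r) _ M rfl
    refine ⟨C a * g, fun M' hM' => hg1 M' ?_, ?_⟩
    · rw [mem_support_iff, coeff_C_mul] at hM'
      exact mem_support_iff.2 (right_ne_zero_of_mul hM')
    · have := (detIdeal k m n r).mul_mem_left (C a) hg2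
      rwa [mul_sub, C_mul_monomial, mul_one] at this
  | add p q hp hq =>
    obtain ⟨g, hg1, hg2⟩ := hp
    obtain ⟨g', hg1', hg2'⟩ := hq
    refine ⟨g + g', fun M' hM' => ?_, ?_⟩
    · rcases Finset.mem_union.1 (Finset.mem_of_subset support_add hM') with h | h
      · exact hg1 _ h
      · exact hg1' _ h
    · convert (detIdeal k m n r).add_mem hg2 hg2' using 1
      ring

lemma eval_eq_zero {k : Type*} [Field k] {m n r : ℕ} (f : MvPolynomial (Fin m × Fin n) k)
    (hf : f ∈ detIdeal k m n r) (A : Matrix (Fin m) (Fin r) k) (B : Matrix (Fin r) (Fin n) k) :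
    eval (fun p => (A * B) p.1 p.2) f = 0 := by
  suffices h : detIdeal k m n r ≤ RingHom.ker (eval (fun p : Fin m × Fin n => (A * B) p.1 p.2)) from
    h hf
  refine Ideal.span_le.2 ?_
  rintro _ ⟨u, v, hu, hv, rfl⟩
  rw [SetLike.mem_coe, RingHom.mem_ker, RingHom.map_det]
  have : (eval (fun p : Fin m × Fin n => (A * B) p.1 p.2)).mapMatrix
      (Matrix.of fun i j => (X (u i, v j) : MvPolynomial (Fin m × Fin n) k)) =
      A.submatrix u id * B.submatrix id v := by
    ext i j
    simp [Matrix.mul_apply]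
  rw [this]
  by_contra hdet
  have h1 := Matrix.rank_of_isUnit _ ((Matrix.isUnit_iff_isUnit_det _).2 (isUnit_iff_ne_zero.2 hdet))
  have h2 := Matrix.rank_mul_le_left (A.submatrix u id) (B.submatrix id v)
  have h3 := Matrix.rank_le_width (A.submatrix u id)
  rw [Fintype.card_fin] at h1
  omega

lemma eval_phi {k : Type*} [Field k] {m n r : ℕ} (f : MvPolynomial (Fin m × Fin n) k)
    (x : (Fin m × Fin r) ⊕ (Fin r × Fin n) → k) :
    eval x (phi k m n r f) = eval (fun p =>
      ((Matrix.of fun i c => x (Sum.inl (i, c))) * (Matrix.of fun c j => x (Sum.inr (c, j))) :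
        Matrix (Fin m) (Fin n) k) p.1 p.2) f := by
  induction f using MvPolynomial.induction_on with
  | C a => simp [phi]
  | add p q hp hq => simp only [map_add, hp, hq]
  | mul_X p i hp =>
    simp only [map_mul, hp]
    simp [phi, Matrix.mul_apply]

/-- Second fundamental theorem. -/
lemma mem_of_eval {k : Type*} [Field k] [CharZero k] {m n r : ℕ} (hr : 0 < r)
    (f : MvPolynomial (Fin m × Fin n) k)
    (h : ∀ (A : Matrix (Fin m) (Fin r) k) (B : Matrix (Fin r) (Fin n) k),
      eval (fun p => (A * B) p.1 p.2) f = 0) : f ∈ detIdeal k m n r := by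
  obtain ⟨g, hg1, hg2⟩ := exists_good (r := r) f
  have hg0 : g = 0 := by
    refine good_zero hr g hg1 ?_
    refine MvPolynomial.funext fun x => ?_
    rw [eval_phi, map_zero]
    have h1 := eval_eq_zero _ hg2 (Matrix.of fun i c => x (Sum.inl (i, c)))
      (Matrix.of fun c j => x (Sum.inr (c, j)))
    rw [map_sub, h, zero_sub, neg_eq_zero] at h1
    exact h1
  rwa [hg0, sub_zero] at hg2

end DetSFT

open DetSFT in
/-- Unique completability descends from rank `r` to any rank `r'` with `1 ≤ r' < r`. -/
theorem uniquelyCompletable_descend {k : Type*} [Field k] [CharZero k]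
    {m n r : ℕ} (hrm : r < m) (hrn : r < n)
    (Ω : Finset (Fin m × Fin n))
    (h : UniquelyCompletable k m n r Ω)
    (r' : ℕ) (hr'1 : 1 ≤ r') (hr' : r' < r) :
    UniquelyCompletable k m n r' Ω := by
  obtain ⟨s, rfl⟩ := Nat.exists_eq_add_of_le hr'.le
  intro p
  obtain ⟨a, b, ha, hb, hb0, hab⟩ := h p
  rw [ne_eq, Ideal.Quotient.eq_zero_iff_mem] at hb0
  rw [← map_mul, Ideal.Quotient.eq] at hab
  have hex : ∃ (A : Matrix (Fin m) (Fin (r' + s)) k) (B : Matrix (Fin (r' + s)) (Fin n) k),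
      eval (fun p => (A * B) p.1 p.2) b ≠ 0 := by
    by_contra hc
    push Not at hc
    exact hb0 (mem_of_eval (by omega) b hc)
  obtain ⟨A, B, hAB⟩ := hex
  let E : Fin m × Fin n → k := fun q => ∑ c : Fin s, A q.1 (Fin.natAdd r' c) * B (Fin.natAdd r' c) q.2
  let τ : MvPolynomial (Fin m × Fin n) k →ₐ[k] MvPolynomial (Fin m × Fin n) k :=
    aeval (fun q => X q + C (E q))
  have hτe : ∀ (x : Fin m × Fin n → k) (f : MvPolynomial (Fin m × Fin n) k),
      eval x (τ f) = eval (fun q => x q + E q) f := by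
    intro x f
    induction f using MvPolynomial.induction_on with
    | C a => simp [τ]
    | add p q hp hq => simp only [map_add, hp, hq]
    | mul_X p i hp =>
      simp only [map_mul, hp]
      simp [τ]
  have hτs : ∀ f ∈ supported k (↑Ω : Set (Fin m × Fin n)),
      τ f ∈ supported k (↑Ω : Set (Fin m × Fin n)) := by
    intro f hf
    have hle : supported k (↑Ω : Set (Fin m × Fin n)) ≤
        (supported k (↑Ω : Set (Fin m × Fin n))).comap τ := by
      conv_lhs => rw [supported_eq_adjoin_X]
      refine Algebra.adjoin_le ?_
      rintro _ ⟨q, hq, rfl⟩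
      show τ (X q) ∈ supported k (↑Ω : Set (Fin m × Fin n))
      simp only [τ, aeval_X]
      refine Subalgebra.add_mem _ (Algebra.subset_adjoin ⟨q, hq, rfl⟩) ?_
      exact Subalgebra.algebraMap_mem _ (E q)
    exact hle hf
  refine ⟨τ a - C (E p) * τ b, τ b, ?_, hτs b hb, ?_, ?_⟩
  · refine Subalgebra.sub_mem _ (hτs a ha) (Subalgebra.mul_mem _ ?_ (hτs b hb))
    exact Subalgebra.algebraMap_mem _ (E p)
  · rw [ne_eq, Ideal.Quotient.eq_zero_iff_mem]
    intro hmem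
    have := eval_eq_zero _ hmem (Matrix.of fun i c => A i (Fin.castAdd s c))
      (Matrix.of fun c j => B (Fin.castAdd s c) j)
    rw [hτe] at this
    apply hAB
    rw [← this]
    congr 2
    funext q
    simp [Matrix.mul_apply, Fin.sum_univ_add, E]
  · rw [← map_mul, Ideal.Quotient.eq]
    refine mem_of_eval hr'1 _ fun A' B' => ?_
    have := eval_eq_zero _ hab
      (Matrix.of fun i => Fin.append (A' i) (fun c => A i (Fin.natAdd r' c)))
      (Matrix.of fun c j => Fin.append (fun c => B' c j) (fun c => B (Fin.natAdd r' c) j) c)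
    have hpt : (fun q : Fin m × Fin n =>
        ((Matrix.of fun i => Fin.append (A' i) (fun c => A i (Fin.natAdd r' c))) *
        (Matrix.of fun c j => Fin.append (fun c => B' c j) (fun c => B (Fin.natAdd r' c) j) c) :
          Matrix (Fin m) (Fin n) k) q.1 q.2) = fun q => (A' * B') q.1 q.2 + E q := by
      funext q
      simp [Matrix.mul_apply, Fin.sum_univ_add, E]
    rw [hpt] at this
    simp only [map_sub, map_mul, hτe, eval_X, eval_C] at this ⊢
    linear_combination this
end

section
/- Let Z' be an (m+1) × (n+1) matrix of variables and Z its upper-left m × n submatrix. In the localization k[Z']_{z'_{(m+1)(n+1)}} where the corner variable is inverted, the ideal of (r+2)-minors I_{r+2}(Z') extends to the ideal of (r+1)-minors of the m × n matrix Y with entries y_{ij} = z_{ij} − z'_{(m+1)j} · (z'_{(m+1)(n+1)})^{−1} · z'_{i(n+1)}; moreover the (m+1)(n+1) elements {y_{ij} : i ≤ m, j ≤ n} together with the variables {z'_{i(n+1)} : i ≤ m+1} ∪ {z'_{(m+1)j} : j ≤ n} are algebraically independent over k. -/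
open MvPolynomial

/-- The corner variable `z'_{(m+1)(n+1)}` of the `(m+1) × (n+1)` matrix of variables. -/
noncomputable def cornerVar (k : Type*) [CommRing k] (m n : ℕ) :
    MvPolynomial (Fin (m + 1) × Fin (n + 1)) k :=
  X (Fin.last m, Fin.last n)

/-- The localization of `k[Z']` at the corner variable. -/
noncomputable abbrev LocCorner (k : Type*) [CommRing k] (m n : ℕ) :=
  Localization.Away (cornerVar k m n)

/-- The entry `y_{ij} = z_{ij} - z'_{(m+1)j} (z'_{(m+1)(n+1)})⁻¹ z'_{i(n+1)}` of the matrix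
`Y` in the localization inverting the corner variable. -/
noncomputable def Yent (k : Type*) [CommRing k] (m n : ℕ) (i : Fin m) (j : Fin n) :
    LocCorner k m n :=
  algebraMap (MvPolynomial (Fin (m + 1) × Fin (n + 1)) k) (LocCorner k m n)
      (X (i.castSucc, j.castSucc)) -
    algebraMap (MvPolynomial (Fin (m + 1) × Fin (n + 1)) k) (LocCorner k m n)
        (X (Fin.last m, j.castSucc)) *
      Localization.Away.invSelf (cornerVar k m n) *
      algebraMap (MvPolynomial (Fin (m + 1) × Fin (n + 1)) k) (LocCorner k m n)
        (X (i.castSucc, Fin.last n))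

/-- The ideal of `(r+1)`-minors of the matrix `Y` in the localization. -/
noncomputable def minorsY (k : Type*) [CommRing k] (m n r : ℕ) : Ideal (LocCorner k m n) :=
  Ideal.span { q | ∃ f : Fin (r + 1) → Fin m, ∃ g : Fin (r + 1) → Fin n,
    Function.Injective f ∧ Function.Injective g ∧
    q = (Matrix.of fun a b => Yent k m n (f a) (g b)).det }

theorem det_bordered {R : Type*} [CommRing R] {s : ℕ}
    (N : Matrix (Fin (s + 1)) (Fin (s + 1)) R) (u : R) (hu : N 0 0 * u = 1) :
    N.det = N 0 0 *
      (Matrix.of fun i j : Fin s => N i.succ j.succ - N 0 j.succ * u * N i.succ 0).det := by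
  let A : Matrix (Fin (s + 1)) (Fin (s + 1)) R := Matrix.of fun i j =>
    N i j + (Fin.cases 0 (fun i' => - (N i'.succ 0 * u)) i : R) * N 0 j
  have hA : A.det = N.det :=
    Matrix.det_eq_of_forall_row_eq_smul_add_const
      (fun i => (Fin.cases 0 (fun i' => - (N i'.succ 0 * u)) i : R)) 0 rfl (fun i j => rfl)
  rw [← hA, Matrix.det_succ_column_zero, Fin.sum_univ_succ]
  have h0 : ∀ i : Fin s, A i.succ 0 = 0 := by
    intro i
    simp only [A, Matrix.of_apply, Fin.cases_succ]
    linear_combination (- N i.succ 0) * hu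
  have h1 : A 0 0 = N 0 0 := by simp [A]
  rw [Finset.sum_eq_zero (by intro i _; rw [h0]; ring), h1]
  simp only [Fin.val_zero, pow_zero, one_mul, add_zero]
  congr 2
  ext i j
  simp only [A, Matrix.submatrix_apply, Matrix.of_apply, Fin.succAbove_zero, Fin.cases_succ]
  ring

theorem det_rank_one_mem {R : Type*} [CommRing R] {s : ℕ}
    (B : Matrix (Fin (s + 1)) (Fin (s + 1)) R) (a b : Fin (s + 1) → R) (J : Ideal R)
    (hJ : ∀ f g : Fin s → Fin (s + 1), (B.submatrix f g).det ∈ J) :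
    (Matrix.of fun i j => B i j + a i * b j).det ∈ J := by
  let M : Matrix (Fin (s + 2)) (Fin (s + 2)) R := Matrix.of fun i j =>
    Fin.cases (Fin.cases 1 (fun j' => - b j') j) (fun i' => Fin.cases (a i') (fun j' => B i' j') j) i
  have hM : M.det = (Matrix.of fun i j => B i j + a i * b j).det := by
    rw [det_bordered M 1 (by simp [M])]
    have : M 0 0 = 1 := by simp [M]
    rw [this, one_mul]
    congr 1
    ext i j
    simp only [M, Matrix.of_apply, Fin.cases_succ, Fin.cases_zero]
    ring
  rw [← hM, Matrix.det_succ_row_zero]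
  refine Ideal.sum_mem _ fun j _ => Ideal.mul_mem_left _ _ ?_
  rw [Matrix.det_succ_column_zero]
  refine Ideal.sum_mem _ fun i _ => Ideal.mul_mem_left _ _ ?_
  have hne : ∀ x : Fin s, j.succAbove x.succ ≠ 0 := by
    intro x hx
    have h := Fin.strictMono_succAbove j (Fin.succ_pos x)
    rw [hx] at h
    exact absurd h (Fin.not_lt_zero _)
  convert hJ i.succAbove (fun x => (j.succAbove x.succ).pred (hne x)) using 2
  ext x y
  simp only [Matrix.submatrix_apply]
  conv_lhs => rw [← Fin.succ_pred _ (hne y)]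
  simp only [M, Matrix.of_apply, Fin.cases_succ]

theorem corner_inv (k : Type*) [CommRing k] (m n : ℕ) :
    algebraMap (MvPolynomial (Fin (m + 1) × Fin (n + 1)) k) (LocCorner k m n)
      (X (Fin.last m, Fin.last n)) * Localization.Away.invSelf (cornerVar k m n) = 1 := by
  rw [Localization.Away.invSelf, Localization.mk_eq_mk']
  have h := IsLocalization.mk'_spec' (LocCorner k m n) (1 : MvPolynomial _ k)
    (⟨cornerVar k m n, Submonoid.mem_powers _⟩ : Submonoid.powers (cornerVar k m n))
  rw [map_one] at h
  exact h

theorem minors_mem (k : Type*) [CommRing k] (m n r : ℕ)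
    (f : Fin (r + 1) → Fin (m + 1)) (g : Fin (r + 1) → Fin (n + 1)) :
    (Matrix.of fun a b =>
      algebraMap (MvPolynomial (Fin (m + 1) × Fin (n + 1)) k) (LocCorner k m n) (X (f a, g b)) -
      algebraMap (MvPolynomial (Fin (m + 1) × Fin (n + 1)) k) (LocCorner k m n)
        (X (Fin.last m, g b)) * Localization.Away.invSelf (cornerVar k m n) *
      algebraMap (MvPolynomial (Fin (m + 1) × Fin (n + 1)) k) (LocCorner k m n)
        (X (f a, Fin.last n))).det ∈ minorsY k m n r := by
  have hc := corner_inv k m n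
  by_cases hf : ∃ a, f a = Fin.last m
  · obtain ⟨a, ha⟩ := hf
    rw [Matrix.det_eq_zero_of_row_eq_zero a]
    · exact Ideal.zero_mem _
    · intro b
      simp only [Matrix.of_apply, ha]
      linear_combination (- algebraMap (MvPolynomial (Fin (m + 1) × Fin (n + 1)) k)
        (LocCorner k m n) (X (Fin.last m, g b))) * hc
  by_cases hg : ∃ b, g b = Fin.last n
  · obtain ⟨b, hb⟩ := hg
    rw [Matrix.det_eq_zero_of_column_eq_zero b]
    · exact Ideal.zero_mem _
    · intro a
      simp only [Matrix.of_apply, hb]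
      linear_combination (- algebraMap (MvPolynomial (Fin (m + 1) × Fin (n + 1)) k)
        (LocCorner k m n) (X (f a, Fin.last n))) * hc
  push Not at hf hg
  by_cases hfi : Function.Injective f
  swap
  · simp only [Function.Injective] at hfi
    push Not at hfi
    obtain ⟨x, y, hxy, hne⟩ := hfi
    rw [Matrix.det_zero_of_row_eq hne]
    · exact Ideal.zero_mem _
    · ext b
      simp only [Matrix.of_apply, hxy]
  by_cases hgi : Function.Injective g
  swap
  · simp only [Function.Injective] at hgi
    push Not at hgi
    obtain ⟨x, y, hxy, hne⟩ := hgi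
    rw [Matrix.det_zero_of_column_eq hne]
    · exact Ideal.zero_mem _
    · intro b
      simp only [Matrix.of_apply, hxy]
  refine Ideal.subset_span ⟨fun a => (f a).castPred (hf a), fun b => (g b).castPred (hg b),
    ?_, ?_, ?_⟩
  · intro x y h
    exact hfi (Fin.castPred_inj.1 h)
  · intro x y h
    exact hgi (Fin.castPred_inj.1 h)
  · simp only [Yent, Fin.castSucc_castPred]

theorem ideal_part (k : Type*) [CommRing k] (m n r : ℕ) :
    (detIdeal k (m + 1) (n + 1) (r + 1)).map
        (algebraMap (MvPolynomial (Fin (m + 1) × Fin (n + 1)) k) (LocCorner k m n)) =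
      minorsY k m n r := by
  apply le_antisymm
  · rw [detIdeal, Ideal.map_span, Ideal.span_le]
    rintro _ ⟨_, ⟨f, g, hf, hg, rfl⟩, rfl⟩
    have h := det_rank_one_mem (s := r + 1)
      (Matrix.of fun a b =>
      algebraMap (MvPolynomial (Fin (m + 1) × Fin (n + 1)) k) (LocCorner k m n) (X (f a, g b)) -
      algebraMap (MvPolynomial (Fin (m + 1) × Fin (n + 1)) k) (LocCorner k m n)
        (X (Fin.last m, g b)) * Localization.Away.invSelf (cornerVar k m n) *
      algebraMap (MvPolynomial (Fin (m + 1) × Fin (n + 1)) k) (LocCorner k m n)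
        (X (f a, Fin.last n)))
      (fun a => algebraMap (MvPolynomial (Fin (m + 1) × Fin (n + 1)) k) (LocCorner k m n)
        (X (f a, Fin.last n)))
      (fun b => algebraMap (MvPolynomial (Fin (m + 1) × Fin (n + 1)) k) (LocCorner k m n)
        (X (Fin.last m, g b)) * Localization.Away.invSelf (cornerVar k m n))
      (minorsY k m n r) (fun p q => minors_mem k m n r (f ∘ p) (g ∘ q))
    rw [SetLike.mem_coe, RingHom.map_det]
    convert h using 2
    ext a b
    simp only [RingHom.mapMatrix_apply, Matrix.map_apply, Matrix.of_apply]
    ring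
  · rw [minorsY, Ideal.span_le]
    rintro _ ⟨f, g, hf, hg, rfl⟩
    have hc := corner_inv k m n
    let F : Fin (r + 2) → Fin (m + 1) := Fin.cons (Fin.last m) (fun i => (f i).castSucc)
    let G : Fin (r + 2) → Fin (n + 1) := Fin.cons (Fin.last n) (fun i => (g i).castSucc)
    have hF : Function.Injective F := Fin.cons_injective_iff.2
      ⟨by rintro ⟨i, hi⟩; exact (Fin.castSucc_lt_last _).ne hi,
        fun x y h => hf (Fin.castSucc_injective _ h)⟩
    have hG : Function.Injective G := Fin.cons_injective_iff.2
      ⟨by rintro ⟨i, hi⟩; exact (Fin.castSucc_lt_last _).ne hi,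
        fun x y h => hg (Fin.castSucc_injective _ h)⟩
    have hmem := Ideal.mem_map_of_mem
      (algebraMap (MvPolynomial (Fin (m + 1) × Fin (n + 1)) k) (LocCorner k m n))
      (show _ ∈ detIdeal k (m + 1) (n + 1) (r + 1) from
        Ideal.subset_span ⟨F, G, hF, hG, rfl⟩)
    rw [RingHom.map_det, det_bordered _ (Localization.Away.invSelf (cornerVar k m n)) hc] at hmem
    have h2 := Ideal.mul_mem_left _ (Localization.Away.invSelf (cornerVar k m n)) hmem
    rw [← mul_assoc] at h2
    have h3 : Localization.Away.invSelf (cornerVar k m n) *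
      ((algebraMap (MvPolynomial (Fin (m + 1) × Fin (n + 1)) k) (LocCorner k m n)).mapMatrix
        (Matrix.of fun i j => X (F i, G j))) 0 0 = 1 := by
      rw [mul_comm]; exact hc
    rw [h3, one_mul] at h2
    exact h2

theorem indep_part (k : Type*) [Field k] (m n : ℕ) :
    AlgebraicIndependent k
      (Sum.elim (fun p : Fin m × Fin n => Yent k m n p.1 p.2)
        (Sum.elim
          (fun i : Fin (m + 1) =>
            (algebraMap (MvPolynomial (Fin (m + 1) × Fin (n + 1)) k) (LocCorner k m n))
              (X (i, Fin.last n)))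
          (fun j : Fin n =>
            (algebraMap (MvPolynomial (Fin (m + 1) × Fin (n + 1)) k) (LocCorner k m n))
              (X (Fin.last m, j.castSucc))))) := by
  let T := (Fin m × Fin n) ⊕ (Fin (m + 1) ⊕ Fin n)
  let P := MvPolynomial T k
  let K := FractionRing P
  let v : T → K := fun t => algebraMap P K (X t)
  have hv : AlgebraicIndependent k v := by
    have h := (MvPolynomial.algebraicIndependent_X T k).map'
      (f := IsScalarTower.toAlgHom k P K) (IsFractionRing.injective P K)
    exact h
  let c : K := v (Sum.inr (Sum.inl (Fin.last m)))
  have hc0 : c ≠ 0 := hv.ne_zero _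
  let w : Fin (m + 1) × Fin (n + 1) → K := fun p =>
    Fin.lastCases (motive := fun _ => K) (v (Sum.inr (Sum.inl p.1)))
      (fun j => Fin.lastCases (motive := fun _ => K) (v (Sum.inr (Sum.inr j)))
        (fun i => v (Sum.inl (i, j)) + v (Sum.inr (Sum.inr j)) * c⁻¹ *
          v (Sum.inr (Sum.inl i.castSucc))) p.1) p.2
  have w1 : ∀ i, w (i, Fin.last n) = v (Sum.inr (Sum.inl i)) := by
    intro i; simp [w]
  have w2 : ∀ j : Fin n, w (Fin.last m, j.castSucc) = v (Sum.inr (Sum.inr j)) := by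
    intro j; simp [w]
  have w3 : ∀ (i : Fin m) (j : Fin n), w (i.castSucc, j.castSucc) =
      v (Sum.inl (i, j)) + v (Sum.inr (Sum.inr j)) * c⁻¹ *
          v (Sum.inr (Sum.inl i.castSucc)) := by
    intro i j; simp [w]
  let φ : MvPolynomial (Fin (m + 1) × Fin (n + 1)) k →ₐ[k] K := aeval w
  have hφ : ∀ y : Submonoid.powers (cornerVar k m n), IsUnit (φ y) := by
    rintro ⟨_, e, rfl⟩
    simp only [φ, cornerVar, map_pow, aeval_X, w1]
    exact (IsUnit.mk0 c hc0).pow e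
  let ψ : LocCorner k m n →ₐ[k] K := IsLocalization.liftAlgHom hφ
  have hψ : ∀ p, ψ (algebraMap (MvPolynomial (Fin (m + 1) × Fin (n + 1)) k)
      (LocCorner k m n) (X p)) = w p := by
    intro p
    have : ψ (algebraMap (MvPolynomial (Fin (m + 1) × Fin (n + 1)) k)
      (LocCorner k m n) (X p)) = φ (X p) := IsLocalization.lift_eq hφ _
    rw [this]
    exact aeval_X _ _
  have hinv : ψ (Localization.Away.invSelf (cornerVar k m n)) = c⁻¹ := by
    have h := congrArg ψ (corner_inv k m n)
    rw [map_mul, hψ, w1, map_one] at h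
    exact eq_inv_of_mul_eq_one_right h
  apply AlgebraicIndependent.of_comp ψ
  convert hv using 1
  funext t
  rcases t with ⟨i, j⟩ | i | j
  · simp only [Function.comp_apply, Sum.elim_inl, Yent, map_sub, map_mul, hψ, hinv, w1, w2, w3]
    ring
  · simp only [Function.comp_apply, Sum.elim_inl, Sum.elim_inr, hψ, w1]
  · simp only [Function.comp_apply, Sum.elim_inr, hψ, w2]

/-- In the localization of `k[Z']` inverting the corner variable, the ideal of
`(r+2)`-minors of `Z'` extends to the ideal of `(r+1)`-minors of `Y`, and the entries of
`Y` together with the last-column and last-row variables are algebraically independent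
over `k`. -/
theorem localization_trick (k : Type*) [Field k] (m n r : ℕ) :
    (detIdeal k (m + 1) (n + 1) (r + 1)).map
        (algebraMap (MvPolynomial (Fin (m + 1) × Fin (n + 1)) k) (LocCorner k m n)) =
      minorsY k m n r ∧
    AlgebraicIndependent k
      (Sum.elim (fun p : Fin m × Fin n => Yent k m n p.1 p.2)
        (Sum.elim
          (fun i : Fin (m + 1) =>
            (algebraMap (MvPolynomial (Fin (m + 1) × Fin (n + 1)) k) (LocCorner k m n))
              (X (i, Fin.last n)))
          (fun j : Fin n =>
            (algebraMap (MvPolynomial (Fin (m + 1) × Fin (n + 1)) k) (LocCorner k m n))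
              (X (Fin.last m, j.castSucc))))) := by
  exact ⟨ideal_part k m n r, indep_part k m n⟩
end

section
/- Let Ω ⊆ [m] × [n] with m ≤ n and r = m − 1 < min(m,n). Then Ω is uniquely completable at rank m−1 if and only if |ω_j| ≥ m−1 for all j ∈ [n] and there exists J ⊆ [n] with |J| = m−1 and [m] × J ⊆ Ω. In particular, if such a J exists and |ω_j| ≥ m−1 for all j, then for every (α,β) ∉ Ω the class z̄_{αβ} lies in the field k(Z̄_Ω), because the (fully observed) m-minor det(Z̄_{[m], J ∪ {β}}) vanishes in k(Z̄) and is linear in z̄_{αβ} with nonzero leading coefficient. -/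
open MvPolynomial

set_option linter.unusedSectionVars false
set_option linter.unusedSimpArgs false
namespace UC

section gen
variable {K : Type*} [CommRing K] {ι κ : Type*} [DecidableEq ι] [DecidableEq κ] [Fintype κ]

theorem leib_prod {R A : Type*} [CommRing R] [CommRing A] [Algebra R A] (D : Derivation R A A)
    {α : Type*} [DecidableEq α] (s : Finset α) (a : α → A) :
    D (∏ i ∈ s, a i) = ∑ i ∈ s, ∏ j ∈ s, Function.update a i (D (a i)) j := by
  induction s using Finset.induction_on with
  | empty => simp
  | insert x s hx ih =>
    rw [Finset.prod_insert hx, Derivation.leibniz, ih, Finset.sum_insert hx, Finset.prod_insert hx]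
    have h1 : ∏ j ∈ s, Function.update a x (D (a x)) j = ∏ j ∈ s, a j := by
      refine Finset.prod_congr rfl fun j hj => ?_
      rw [Function.update_of_ne]; rintro rfl; exact hx hj
    rw [h1]
    simp only [Function.update_self, smul_eq_mul, Finset.mul_sum]
    rw [add_comm, mul_comm]
    congr 1
    refine Finset.sum_congr rfl fun j hj => ?_
    rw [Finset.prod_insert hx, Function.update_of_ne]; rintro rfl; exact hx hj

theorem der_det {R A : Type*} [CommRing R] [CommRing A] [Algebra R A] (D : Derivation R A A)
    {α : Type*} [DecidableEq α] [Fintype α] (M : Matrix α α A) :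
    D M.det = ∑ i, (M.updateRow i (fun j => D (M i j))).det := by
  simp only [← Matrix.det_transpose M, ← Matrix.det_transpose (Matrix.updateRow _ _ _)]
  simp only [Matrix.det_apply, map_sum, Matrix.transpose_apply]
  rw [Finset.sum_comm]
  refine Finset.sum_congr rfl fun σ _ => ?_
  rw [← Finset.smul_sum, Units.smul_def, map_zsmul, Units.smul_def, leib_prod]
  congr 1
  refine Finset.sum_congr rfl fun i _ => Finset.prod_congr rfl fun j _ => ?_
  by_cases h : j = i
  · subst h; simp
  · simp [Function.update_of_ne h, Matrix.updateRow_ne h]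

/-- polarization operator -/
noncomputable def E (a b : ι) : Derivation K (MvPolynomial (ι × κ) K) (MvPolynomial (ι × κ) K) :=
  ∑ c, (X (a, c) : MvPolynomial (ι × κ) K) • pderiv (b, c)

theorem sum_der_apply {R A α : Type*} [CommRing R] [CommRing A] [Algebra R A] (s : Finset α)
    (D : α → Derivation R A A) (f : A) : (∑ i ∈ s, D i) f = ∑ i ∈ s, D i f := by
  classical
  induction s using Finset.induction_on with
  | empty => simp
  | insert x s hx ih => simp [Finset.sum_insert hx, ih]

theorem E_apply (a b : ι) (f : MvPolynomial (ι × κ) K) :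
    E a b f = ∑ c, X (a, c) * pderiv (b, c) f := by
  simp [E, sum_der_apply]

theorem E_X (a b i : ι) (c : κ) :
    E a b (X (i, c) : MvPolynomial (ι × κ) K) = if i = b then X (a, c) else 0 := by
  rw [E_apply]
  by_cases h : i = b
  · subst h
    simp [pderiv_X, Pi.single_apply]
  · rw [if_neg h]
    refine Finset.sum_eq_zero fun d _ => ?_
    rw [pderiv_X_of_ne, mul_zero]
    intro h'; exact h (Prod.ext_iff.1 h').1

theorem pderiv_comm {τ : Type*} (i j : τ) (f : MvPolynomial τ K) :
    pderiv i (pderiv j f) = pderiv j (pderiv i f) := by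
  classical
  have : ⁅(pderiv i : Derivation K (MvPolynomial τ K) (MvPolynomial τ K)),
      (pderiv j : Derivation K (MvPolynomial τ K) (MvPolynomial τ K))⁆ = 0 := by
    apply MvPolynomial.derivation_ext
    intro l
    simp [Derivation.commutator_apply, pderiv_X, Pi.single_apply, apply_ite]
  have h := congrArg (fun D => D f) this
  simpa [Derivation.commutator_apply, sub_eq_zero] using h

/-- normal-ordered products of polarization operators -/
noncomputable def N : (r : ℕ) → (a b : Fin r → ι) → MvPolynomial (ι × κ) K →ₗ[K] MvPolynomial (ι × κ) K
  | 0, _, _ => LinearMap.id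
  | r + 1, a, b => ∑ c : κ, (LinearMap.mulLeft K (X (a 0, c) : MvPolynomial (ι × κ) K)) ∘ₗ
      (N r (fun i => a i.succ) (fun i => b i.succ)) ∘ₗ (pderiv (b 0, c)).toLinearMap

theorem N_zero (a b : Fin 0 → ι) (f : MvPolynomial (ι × κ) K) : N 0 a b f = f := rfl

theorem N_succ (r : ℕ) (a b : Fin (r+1) → ι) (f : MvPolynomial (ι × κ) K) :
    N (r+1) a b f = ∑ c, X (a 0, c) * N r (fun i => a i.succ) (fun i => b i.succ)
      (pderiv (b 0, c) f) := by
  simp [N]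

theorem N_comm (s t : ι) : ∀ (r : ℕ) (a b : Fin r → ι) (f : MvPolynomial (ι × κ) K),
    ∑ c : κ, N r a b (X (s, c) * pderiv (t, c) f) = ∑ c : κ, X (s, c) * N r a b (pderiv (t, c) f)
      + ∑ j, if b j = s then N r a (Function.update b j t) f else 0 := by
  intro r
  induction r with
  | zero => intro a b f; simp [N_zero]
  | succ r ih =>
    intro a b f
    have key : ∀ c d : κ, pderiv (b 0, d) (X (s, c) * pderiv (t, c) f) =
        (if b 0 = s then (if d = c then pderiv (t, c) f else 0) else 0) +
          X (s, c) * pderiv (t, c) (pderiv (b 0, d) f) := by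
      intro c d
      rw [pderiv_mul, pderiv_comm (b 0, d)]
      congr 1
      by_cases h : b 0 = s
      · by_cases h' : d = c
        · subst h' h; simp
        · rw [pderiv_X_of_ne (by simpa using fun _ h2 => h' h2.symm)]; simp [h']
      · rw [pderiv_X_of_ne (by simpa using fun h2 _ => h h2.symm)]; simp [h]
    have hA : ∀ d : κ, ∑ c, N r (fun i => a i.succ) (fun i => b i.succ)
        (pderiv (b 0, d) (X (s, c) * pderiv (t, c) f)) =
        (if b 0 = s then N r (fun i => a i.succ) (fun i => b i.succ) (pderiv (t, d) f) else 0) +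
        (∑ c, X (s, c) * N r (fun i => a i.succ) (fun i => b i.succ)
            (pderiv (t, c) (pderiv (b 0, d) f)) +
         ∑ j : Fin r, if b j.succ = s then N r (fun i => a i.succ)
            (Function.update (fun i => b i.succ) j t) (pderiv (b 0, d) f) else 0) := by
      intro d
      rw [← ih]
      simp only [key, map_add, Finset.sum_add_distrib]
      congr 1
      by_cases h : b 0 = s
      · simp only [h, if_true]
        rw [Finset.sum_eq_single d]
        · simp
        · intro c _ hc
          rw [if_neg (Ne.symm hc), map_zero]
        · simp
      · simp [h]
    have hB : ∑ c, N (r+1) a b (X (s, c) * pderiv (t, c) f) =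
        ∑ d, X (a 0, d) * ∑ c, N r (fun i => a i.succ) (fun i => b i.succ)
        (pderiv (b 0, d) (X (s, c) * pderiv (t, c) f)) := by
      simp only [N_succ]
      rw [Finset.sum_comm]
      simp only [Finset.mul_sum]
    rw [hB]
    simp only [hA]
    rw [Fin.sum_univ_succ]
    have h0 : (if b 0 = s then N (r+1) a (Function.update b 0 t) f else 0) =
        ∑ d, X (a 0, d) * (if b 0 = s then N r (fun i => a i.succ) (fun i => b i.succ)
          (pderiv (t, d) f) else 0) := by
      by_cases h : b 0 = s
      · simp only [h, if_true, N_succ, Function.update_self,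
          Function.update_of_ne (Fin.succ_ne_zero _)]
      · simp [h]
    have h1 : ∀ j : Fin r, (if b j.succ = s then N (r+1) a (Function.update b j.succ t) f else 0) =
        ∑ d, X (a 0, d) * (if b j.succ = s then N r (fun i => a i.succ)
            (Function.update (fun i => b i.succ) j t) (pderiv (b 0, d) f) else 0) := by
      intro j
      by_cases h : b j.succ = s
      · simp only [h, if_true, N_succ]
        refine Finset.sum_congr rfl fun d _ => ?_
        rw [Function.update_of_ne (Fin.succ_ne_zero _).symm]
        have : (fun i : Fin r => Function.update b j.succ t i.succ) =
            Function.update (fun i => b i.succ) j t := by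
          funext i
          simp [Function.update_apply]
        rw [this]
      · simp [h]
    have h2 : ∑ c, X (s, c) * N (r+1) a b (pderiv (t, c) f) =
        ∑ d, X (a 0, d) * ∑ c, X (s, c) * N r (fun i => a i.succ) (fun i => b i.succ)
            (pderiv (t, c) (pderiv (b 0, d) f)) := by
      simp only [N_succ, Finset.mul_sum]
      rw [Finset.sum_comm]
      refine Finset.sum_congr rfl fun d _ => Finset.sum_congr rfl fun c _ => ?_
      rw [pderiv_comm, mul_left_comm]
    rw [h0, h2]
    simp only [h1]
    rw [Finset.sum_comm]
    simp only [← Finset.mul_sum, ← Finset.sum_add_distrib, ← mul_add]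
    refine Finset.sum_congr rfl fun d _ => ?_
    rw [add_left_comm]

theorem N_succ' (r : ℕ) (a b : Fin (r+1) → ι) (f : MvPolynomial (ι × κ) K) :
    N (r+1) a b f = N r (fun i => a i.succ) (fun i => b i.succ) (E (a 0) (b 0) f) -
      ∑ j : Fin r, if b j.succ = a 0 then
        N r (fun i => a i.succ) (Function.update (fun i => b i.succ) j (b 0)) f else 0 := by
  rw [E_apply, map_sum, N_comm, N_succ]; ring

theorem N_mem (I : Ideal (MvPolynomial (ι × κ) K)) (hI : ∀ a b, ∀ f ∈ I, E a b f ∈ I) :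
    ∀ (r : ℕ) (a b : Fin r → ι), ∀ f ∈ I, N r a b f ∈ I := by
  intro r
  induction r with
  | zero => intro a b f hf; exact hf
  | succ r ih =>
    intro a b f hf
    rw [N_succ']
    refine I.sub_mem (ih _ _ _ (hI _ _ _ hf)) (I.sum_mem fun j _ => ?_)
    split_ifs
    · exact ih _ _ _ hf
    · exact I.zero_mem

noncomputable def T (r : ℕ) (e : Fin r → ι) (f : MvPolynomial (ι × κ) K) : MvPolynomial (ι × κ) K :=
  ∑ σ : Equiv.Perm (Fin r), (Equiv.Perm.sign σ : ℤ) • N r e (e ∘ σ) f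

theorem T_step [LinearOrder ι] (I : Ideal (MvPolynomial (ι × κ) K))
    (hI : ∀ a b, ∀ f ∈ I, E a b f ∈ I) (h : MvPolynomial (ι × κ) K) (lam : ι → ℕ)
    (h1 : ∀ a b, a < b → E a b h ∈ I) (h2 : ∀ a, E a a h = lam a • h)
    (r : ℕ) (e : Fin (r+1) → ι) (he : StrictMono e) :
    T (r+1) e h - (lam (e 0) + r) • T r (fun i => e i.succ) h ∈ I := by
  have hterm : ∀ (p : Fin (r+1)) (τ : Equiv.Perm (Fin r)),
      Ideal.Quotient.mk I ((Equiv.Perm.sign (Equiv.Perm.decomposeFin.symm (p, τ)) : ℤ) •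
        N (r+1) e (e ∘ (Equiv.Perm.decomposeFin.symm (p, τ))) h) =
      Ideal.Quotient.mk I ((if p = 0 then lam (e 0) else 1) •
        ((Equiv.Perm.sign τ : ℤ) • N r (fun i => e i.succ) ((fun i => e i.succ) ∘ τ) h)) := by
    intro p τ
    rw [N_succ', Equiv.Perm.decomposeFin.symm_sign]
    by_cases hp : p = 0
    · subst hp
      have : ∀ j : Fin r, ¬ (e ((τ j).succ) = e 0) := fun j hj =>
        Fin.succ_ne_zero _ (he.injective hj)
      simp only [Equiv.Perm.decomposeFin_symm_apply_zero, Equiv.Perm.decomposeFin_symm_apply_succ,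
        h2, this, Function.comp_def, map_nsmul, Equiv.swap_self, Equiv.refl_apply, if_false,
        Finset.sum_const_zero, sub_zero, if_true, one_mul]
      rw [smul_comm, map_nsmul]
    · have hlt : e 0 < e p := he (Fin.pos_of_ne_zero hp)
      obtain ⟨q, rfl⟩ := Fin.exists_succ_eq.2 hp
      have hz := N_mem I hI r (fun i => e i.succ)
        (fun i => (e ∘ (Equiv.Perm.decomposeFin.symm (q.succ, τ))) i.succ) _ (h1 _ _ hlt)
      rw [← Ideal.Quotient.eq_zero_iff_mem] at hz
      have hsum : (∑ j : Fin r, if (e ∘ (Equiv.Perm.decomposeFin.symm (q.succ, τ))) j.succ = e 0 then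
        N r (fun i => e i.succ) (Function.update (fun i =>
          (e ∘ (Equiv.Perm.decomposeFin.symm (q.succ, τ))) i.succ) j
          ((e ∘ (Equiv.Perm.decomposeFin.symm (q.succ, τ))) 0)) h else 0) =
          N r (fun i => e i.succ) ((fun i => e i.succ) ∘ τ) h := by
        rw [Finset.sum_eq_single (τ.symm q)]
        · rw [if_pos]
          · congr 1
            congr 1
            funext i
            by_cases hi : i = τ.symm q
            · subst hi; simp [Equiv.Perm.decomposeFin_symm_apply_zero]
            · have : τ i ≠ q := fun h => hi (by rw [← h]; simp)
              simp [Function.update_of_ne hi, Equiv.Perm.decomposeFin_symm_apply_succ]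
              rw [Equiv.swap_apply_of_ne_of_ne (Fin.succ_ne_zero _)]
              simpa using this
          · simp [Equiv.Perm.decomposeFin_symm_apply_succ]
        · intro j _ hj
          rw [if_neg]
          intro h
          have h := he.injective h
          rw [Equiv.Perm.decomposeFin_symm_apply_succ] at h
          have : τ j ≠ q := fun h => hj (by rw [← h]; simp)
          rw [Equiv.swap_apply_of_ne_of_ne (Fin.succ_ne_zero _) (by simpa using this)] at h
          exact Fin.succ_ne_zero _ h
        · simp
      rw [hsum]
      simp only [Function.comp_apply, Equiv.Perm.decomposeFin_symm_apply_zero] at hz ⊢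
      simp only [map_sub, map_zsmul, smul_sub, hz, if_neg hp]
      simp
  rw [← Ideal.Quotient.eq_zero_iff_mem, map_sub, sub_eq_zero]
  unfold T
  rw [← Equiv.sum_comp Equiv.Perm.decomposeFin.symm, Fintype.sum_prod_type, map_sum]
  simp only [map_sum, hterm]
  rw [Fin.sum_univ_succ]
  simp [Fin.succ_ne_zero, add_smul, Finset.smul_sum, Finset.mul_sum, add_mul, Finset.sum_add_distrib]

theorem T_all [LinearOrder ι] (I : Ideal (MvPolynomial (ι × κ) K))
    (hI : ∀ a b, ∀ f ∈ I, E a b f ∈ I) (h : MvPolynomial (ι × κ) K) (lam : ι → ℕ)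
    (hl : ∀ i, 0 < lam i)
    (h1 : ∀ a b, a < b → E a b h ∈ I) (h2 : ∀ a, E a a h = lam a • h) :
    ∀ (r : ℕ) (e : Fin r → ι) (_ : StrictMono e), ∃ q : ℕ, 0 < q ∧ T r e h - q • h ∈ I := by
  intro r
  induction r with
  | zero => intro e _; exact ⟨1, one_pos, by simp [T, N_zero]⟩
  | succ r ih =>
    intro e he
    obtain ⟨q, hq, hm⟩ := ih (fun i => e i.succ) (he.comp (Fin.strictMono_succ))
    refine ⟨(lam (e 0) + r) * q, Nat.mul_pos (by have := hl (e 0); omega) hq, ?_⟩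
    have := I.add_mem (T_step I hI h lam h1 h2 r e he) (I.nsmul_mem hm (lam (e 0) + r))
    rw [smul_sub, sub_add_sub_cancel, smul_smul] at this
    exact this

/-- iterated partial derivatives -/
noncomputable def DD (s : Multiset (ι × κ)) (f : MvPolynomial (ι × κ) K) : MvPolynomial (ι × κ) K :=
  haveI : LeftCommutative (fun (v : ι × κ) (g : MvPolynomial (ι × κ) K) => pderiv v g) :=
    ⟨fun a b f => pderiv_comm a b f⟩
  s.foldr (fun v g => pderiv v g) f

theorem DD_cons (v : ι × κ) (s : Multiset (ι × κ)) (f : MvPolynomial (ι × κ) K) :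
    DD (v ::ₘ s) f = pderiv v (DD s f) := by
  simp [DD]

theorem DD_cons' (v : ι × κ) (s : Multiset (ι × κ)) (f : MvPolynomial (ι × κ) K) :
    DD (v ::ₘ s) f = DD s (pderiv v f) := by
  induction s using Multiset.induction_on with
  | empty => simp [DD]
  | cons w s ih => rw [Multiset.cons_swap, DD_cons, ih, DD_cons]

theorem N_eq : ∀ (r : ℕ) (a b : Fin r → ι) (f : MvPolynomial (ι × κ) K),
    N r a b f = ∑ c : Fin r → κ, (∏ i, X (a i, c i)) *
      DD (Finset.univ.val.map fun i => (b i, c i)) f := by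
  intro r
  induction r with
  | zero => intro a b f; simp [N_zero, DD]
  | succ r ih =>
    intro a b f
    rw [N_succ, ← (Fin.consEquiv fun _ => κ).sum_comp, Fintype.sum_prod_type]
    refine Finset.sum_congr rfl fun c _ => ?_
    rw [ih, Finset.mul_sum]
    refine Finset.sum_congr rfl fun d _ => ?_
    rw [Fin.prod_univ_succ, Fin.univ_succ]
    simp [DD_cons', Fin.consEquiv, mul_assoc, Function.comp_def, -Fin.univ_val_map]

theorem T_eq (r : ℕ) (e : Fin r → ι) (f : MvPolynomial (ι × κ) K) :
    T r e f = ∑ c : Fin r → κ, (Matrix.of fun i j => (X (e i, c j) : MvPolynomial (ι × κ) K)).det *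
      DD (Finset.univ.val.map fun i => (e i, c i)) f := by
  have : ∀ σ : Equiv.Perm (Fin r), N r e (e ∘ σ) f = ∑ c : Fin r → κ, (∏ i, X (e i, c (σ i))) *
      DD (Finset.univ.val.map fun i => (e i, c i)) f := by
    intro σ
    rw [N_eq, ← (Equiv.arrowCongr σ.symm (Equiv.refl κ)).sum_comp]
    refine Finset.sum_congr rfl fun c _ => ?_
    congr 2
    have hm : (Finset.univ.val.map fun i => (e i, c i)) =
        Finset.univ.val.map fun i => (e (σ i), c (σ i)) := by
      conv_lhs => rw [← Finset.map_univ_equiv σ, Finset.map_val, Multiset.map_map]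
      rfl
    rw [hm]
    simp [Equiv.arrowCongr, Function.comp_def, -Fin.univ_val_map]
  unfold T
  simp only [this, Finset.smul_sum]
  rw [Finset.sum_comm]
  refine Finset.sum_congr rfl fun c _ => ?_
  rw [← Matrix.det_transpose, Matrix.det_apply, Finset.sum_mul]
  refine Finset.sum_congr rfl fun σ _ => ?_
  simp [Units.smul_def, mul_assoc]

end gen

section det
variable {k : Type*} [Field k] {r n : ℕ}

theorem E_mem_detIdeal (a b : Fin (r+1)) (f : MvPolynomial (Fin (r+1) × Fin n) k)
    (hf : f ∈ detIdeal k (r+1) n r) : E a b f ∈ detIdeal k (r+1) n r := by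
  unfold detIdeal at hf ⊢
  induction hf using Submodule.span_induction with
  | zero => simp
  | add x y _ _ hx hy => rw [map_add]; exact Ideal.add_mem _ hx hy
  | smul c x hx ih =>
    rw [smul_eq_mul, Derivation.leibniz]
    refine Ideal.add_mem _ (Ideal.mul_mem_left _ _ ih) ?_
    rw [smul_eq_mul]
    exact Ideal.mul_mem_right _ _ hx
  | mem x hx =>
    obtain ⟨f, g, hf, hg, rfl⟩ := hx
    rw [der_det]
    refine Ideal.sum_mem _ fun i _ => ?_
    by_cases hib : f i = b
    · have hM : ((Matrix.of fun i j => (X (f i, g j) : MvPolynomial (Fin (r+1) × Fin n) k)).updateRow i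
          (fun j => E a b (Matrix.of (fun i j => (X (f i, g j) :
            MvPolynomial (Fin (r+1) × Fin n) k)) i j))) =
          Matrix.of fun i' j => X (Function.update f i a i', g j) := by
        ext i' j
        by_cases h : i' = i
        · subst h; simp [E_X, hib]
        · simp [Matrix.updateRow_ne h, Function.update_of_ne h]
      rw [hM]
      by_cases hab : a = b
      · refine Ideal.subset_span ⟨f, g, hf, hg, ?_⟩
        rw [hab, ← hib, Function.update_eq_self]
      · obtain ⟨i', hi'⟩ := (Finite.injective_iff_surjective.1 hf) a
        have hne : i ≠ i' := by rintro rfl; exact hab (hi'.symm.trans hib)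
        rw [Matrix.det_zero_of_row_eq hne]
        · exact Ideal.zero_mem _
        · funext j
          simp [Function.update_of_ne hne.symm, hi']
    · rw [Matrix.det_eq_zero_of_row_eq_zero i]
      · exact Ideal.zero_mem _
      · intro j; simp [E_X, hib]

theorem T_mem (h : MvPolynomial (Fin (r+1) × Fin n) k) : T (r+1) id h ∈ detIdeal k (r+1) n r := by
  rw [T_eq]
  refine Ideal.sum_mem _ fun c _ => Ideal.mul_mem_right _ _ ?_
  by_cases hc : Function.Injective c
  · exact Ideal.subset_span ⟨id, c, Function.injective_id, hc, rfl⟩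
  · simp only [Function.Injective, not_forall] at hc
    obtain ⟨i, j, hij, hne⟩ := hc
    rw [Matrix.det_zero_of_column_eq hne]
    · exact Ideal.zero_mem _
    · intro l; simp [hij]

/-- Coordinate ring of the parametrization -/
abbrev SS (k : Type*) [Field k] (r n : ℕ) :=
  MvPolynomial (Fin (r+1) × Fin r) (MvPolynomial (Fin r × Fin n) k)

/-- Generic parametrization `Z = A B`. -/
noncomputable def par (k : Type*) [Field k] (r n : ℕ) :
    MvPolynomial (Fin (r+1) × Fin n) k →ₐ[k] SS k r n :=
  aeval fun p => ∑ l : Fin r, X (p.1, l) * C (X (l, p.2))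

theorem par_X (i : Fin (r+1)) (c : Fin n) :
    par k r n (X (i, c)) = ∑ l : Fin r, X (i, l) * C (X (l, c)) := by
  simp [par]

theorem par_E (a b : Fin (r+1)) (f : MvPolynomial (Fin (r+1) × Fin n) k) :
    par k r n (E a b f) = E a b (par k r n f) := by
  induction f using MvPolynomial.induction_on with
  | C c =>
    have h1 : E a b (C c : MvPolynomial (Fin (r+1) × Fin n) k) = 0 := by
      rw [← algebraMap_eq, Derivation.map_algebraMap]
    have h2 : par k r n (C c) = algebraMap (MvPolynomial (Fin r × Fin n) k) (SS k r n) (C c) := by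
      rw [← algebraMap_eq, AlgHom.commutes]; rfl
    rw [h1, h2, map_zero, Derivation.map_algebraMap]
  | add p q hp hq => simp only [map_add, hp, hq]
  | mul_X p x hp =>
    obtain ⟨i, c⟩ := x
    simp only [Derivation.leibniz, map_mul, map_add, hp, smul_eq_mul, E_X]
    congr 2
    rw [par_X, map_sum]
    have : ∀ l : Fin r, E a b (X (i, l) * C (X (l, c)) : SS k r n) =
        if i = b then X (a, l) * C (X (l, c)) else 0 := by
      intro l
      rw [mul_comm, ← smul_eq_C_mul, Derivation.map_smul, E_X, smul_eq_C_mul]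
      split_ifs <;> ring
    simp only [this]
    split_ifs
    · rw [par_X]
    · simp

/-- row weight -/
def wt (κ : Type*) (r : ℕ) : Fin (r+1) × κ → (Fin (r+1) → ℕ) := fun p => Pi.single p.1 1

theorem par_wh (d : Fin (r+1) × Fin n →₀ ℕ) (c : k) :
    IsWeightedHomogeneous (wt (Fin r) r) (par k r n (monomial d c))
      (Finsupp.weight (wt (Fin n) r) d) := by
  classical
  rw [monomial_eq, map_mul, Finsupp.prod, map_prod]
  have h2 : par k r n (C c) = C (C c) := by
    rw [← algebraMap_eq, AlgHom.commutes]; rfl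
  rw [h2, ← zero_add (Finsupp.weight (wt (Fin n) r) d)]
  refine (isWeightedHomogeneous_C _ _).mul ?_
  rw [Finsupp.weight_apply, Finsupp.sum]
  refine IsWeightedHomogeneous.prod _ _ _ fun p _ => ?_
  rw [map_pow]
  refine IsWeightedHomogeneous.pow ?_ _
  obtain ⟨i, c⟩ := p
  rw [par_X]
  refine IsWeightedHomogeneous.sum _ _ _ fun l _ => ?_
  rw [mul_comm]
  exact (isWeightedHomogeneous_X _ _ (i, l)).C_mul _

theorem par_comp (lam : Fin (r+1) → ℕ) (f : MvPolynomial (Fin (r+1) × Fin n) k) :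
    par k r n (weightedHomogeneousComponent (wt (Fin n) r) lam f) =
      weightedHomogeneousComponent (wt (Fin r) r) lam (par k r n f) := by
  classical
  induction f using MvPolynomial.induction_on' with
  | monomial d c =>
    rw [weightedHomogeneousComponent_of_mem (par_wh d c),
      weightedHomogeneousComponent_of_mem (isWeightedHomogeneous_monomial (wt (Fin n) r) d c rfl)]
    split_ifs <;> simp
  | add p q hp hq => simp only [map_add, hp, hq]

theorem par_eq_zero_of_row (s : Fin (r+1)) (f : MvPolynomial (Fin (r+1) × Fin n) k)
    (lam : Fin (r+1) → ℕ) (hf : IsWeightedHomogeneous (wt (Fin n) r) f lam) (hs : lam s = 0)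
    (h : par k r n f = 0) : f = 0 := by
  classical
  -- specialization sending `A` to the unit matrix with zero row `s`
  let ψ : SS k r n →+* MvPolynomial (Fin (r+1) × Fin n) k :=
    eval₂Hom ((aeval fun p : Fin r × Fin n => (X (s.succAbove p.1, p.2) :
      MvPolynomial (Fin (r+1) × Fin n) k)) : MvPolynomial (Fin r × Fin n) k →ₐ[k] _).toRingHom
      (fun p => if p.1 = s.succAbove p.2 then 1 else 0)
  have hψ : ∀ l c, ψ (par k r n (X (s.succAbove l, c))) = X (s.succAbove l, c) := by
    intro l c
    rw [par_X, map_sum]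
    simp [ψ]
  have hC : ∀ c, ψ (par k r n (C c)) = C c := by
    intro c
    have h2 : par k r n (C c) = C (C c) := by
      rw [← algebraMap_eq, AlgHom.commutes]; rfl
    simp [h2, ψ]
  have : ψ (par k r n f) = f := by
    conv_rhs => rw [f.as_sum]
    conv_lhs => rw [f.as_sum]
    rw [map_sum, map_sum]
    refine Finset.sum_congr rfl fun d hd => ?_
    have hw := hf (mem_support_iff.1 hd)
    rw [monomial_eq, map_mul, map_mul, hC, Finsupp.prod, map_prod, map_prod]
    congr 1
    refine Finset.prod_congr rfl fun p hp => ?_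
    obtain ⟨i, c⟩ := p
    have hi : i ≠ s := by
      rintro rfl
      have h3 := congrFun hw i
      rw [hs, Finsupp.weight_apply, Finsupp.sum, Finset.sum_apply, Finset.sum_eq_zero_iff] at h3
      have h4 := h3 _ hp
      simp [wt] at h4
      exact (Finsupp.mem_support_iff.1 hp) h4
    obtain ⟨l, rfl⟩ := Fin.exists_succAbove_eq hi
    rw [map_pow, map_pow, hψ]
  rw [← this, h, map_zero]

theorem wh_E (f : MvPolynomial (Fin (r+1) × Fin n) k) (lam mu : Fin (r+1) → ℕ) (a b : Fin (r+1))
    (hf : IsWeightedHomogeneous (wt (Fin n) r) f lam) (hmu : mu + Pi.single b 1 = lam) :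
    IsWeightedHomogeneous (wt (Fin n) r) (E a b f) (Pi.single a 1 + mu) := by
  rw [E_apply]
  refine IsWeightedHomogeneous.sum _ _ _ fun c _ => ?_
  exact (isWeightedHomogeneous_X _ _ (a, c)).mul (hf.pderiv hmu)

theorem E_self (f : MvPolynomial (Fin (r+1) × Fin n) k) (lam : Fin (r+1) → ℕ) (a : Fin (r+1))
    (hf : IsWeightedHomogeneous (wt (Fin n) r) f lam) : E a a f = lam a • f := by
  have h : IsWeightedHomogeneous (fun p : Fin (r+1) × Fin n => wt (Fin n) r p a) f (lam a) := by
    intro d hd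
    rw [← hf hd]
    simp [Finsupp.weight_apply, Finsupp.sum]
  rw [← h.sum_weight_X_mul_pderiv, E_apply, Fintype.sum_prod_type, Finset.sum_eq_single a]
  · simp [wt]
  · intro b _ hb
    refine Finset.sum_eq_zero fun c _ => ?_
    simp [wt, Pi.single_apply, hb.symm]
  · simp

theorem ker_wh [CharZero k] : ∀ (M : ℕ) (lam : Fin (r+1) → ℕ), ∑ i : Fin (r+1), (i : ℕ) * lam i < M →
    ∀ f : MvPolynomial (Fin (r+1) × Fin n) k, IsWeightedHomogeneous (wt (Fin n) r) f lam →
    par k r n f = 0 → f ∈ detIdeal k (r+1) n r := by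
  intro M
  induction M with
  | zero => intro lam h; omega
  | succ M ih =>
    intro lam hM f hf h0
    by_cases hl : ∀ i, 0 < lam i
    · have h1 : ∀ a b, a < b → E a b f ∈ detIdeal k (r+1) n r := by
        intro a b hab
        have hmu : (Function.update lam b (lam b - 1)) + Pi.single b 1 = lam := by
          funext i
          by_cases h : i = b
          · subst h; have := hl i; simp; omega
          · simp [h]
        refine ih _ ?_ _ (wh_E f lam _ a b hf hmu) (by rw [par_E, h0, map_zero])
        have e1 : ∑ i : Fin (r+1), (i : ℕ) * lam i = ∑ i : Fin (r+1), (i : ℕ) * (Function.update lam b (lam b - 1)) i + b := by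
          conv_lhs => rw [← hmu]
          simp [mul_add, Finset.sum_add_distrib, Pi.single_apply]
        have e2 : ∑ i : Fin (r+1), (i : ℕ) * ((Pi.single a 1 + Function.update lam b (lam b - 1) : Fin (r+1) → ℕ)) i =
            a + ∑ i : Fin (r+1), (i : ℕ) * (Function.update lam b (lam b - 1)) i := by
          simp [mul_add, Finset.sum_add_distrib, Pi.single_apply]
        rw [e2]
        have : (a : ℕ) < b := hab
        omega
      obtain ⟨q, hq, hm⟩ := T_all (detIdeal k (r+1) n r) E_mem_detIdeal f lam hl h1
        (fun a => E_self f lam a hf) (r+1) id strictMono_id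
      have h3 := Ideal.sub_mem _ (T_mem f) hm
      rw [sub_sub_cancel] at h3
      have h4 := Ideal.mul_mem_left _ (C ((q : k)⁻¹)) h3
      have h5 : C ((q : k)⁻¹) * q • f = f := by
        rw [nsmul_eq_mul, ← mul_assoc, ← map_natCast (C : k →+* MvPolynomial (Fin (r+1) × Fin n) k),
          ← C_mul, inv_mul_cancel₀ (by exact_mod_cast hq.ne'), C_1, one_mul]
      rwa [h5] at h4
    · push Not at hl
      obtain ⟨s, hs⟩ := hl
      rw [par_eq_zero_of_row s f lam hf (by omega) h0]
      exact Ideal.zero_mem _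

theorem ker_par [CharZero k] (f : MvPolynomial (Fin (r+1) × Fin n) k) (h : par k r n f = 0) :
    f ∈ detIdeal k (r+1) n r := by
  classical
  rw [← sum_weightedHomogeneousComponent (wt (Fin n) r) f, finsum_eq_sum _
    (weightedHomogeneousComponent_finsupp f)]
  refine Ideal.sum_mem _ fun lam _ => ?_
  refine ker_wh _ lam (Nat.lt_succ_self _) _
    (weightedHomogeneousComponent_isWeightedHomogeneous _ _) ?_
  rw [par_comp, h, map_zero]

end det

section main
variable {k : Type*} [Field k] {r n : ℕ}

theorem kill {T : Type*} [Field T] [Algebra k T] (Z : Matrix (Fin (r+1)) (Fin n) T)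
    (v : Fin (r+1) → T) (hv : v ≠ 0) (hZ : Matrix.vecMul v Z = 0)
    (f : MvPolynomial (Fin (r+1) × Fin n) k) (hf : f ∈ detIdeal k (r+1) n r) :
    aeval (fun p : Fin (r+1) × Fin n => Z p.1 p.2) f = 0 := by
  have : detIdeal k (r+1) n r ≤
      RingHom.ker (aeval (R := k) (fun p : Fin (r+1) × Fin n => Z p.1 p.2)) := by
    refine Ideal.span_le.2 ?_
    rintro _ ⟨f, g, hf, hg, rfl⟩
    rw [SetLike.mem_coe, RingHom.mem_ker, AlgHom.map_det]
    refine Matrix.exists_vecMul_eq_zero_iff.1 ⟨v ∘ f, ?_, ?_⟩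
    · intro h
      apply hv
      funext i
      obtain ⟨j, rfl⟩ := (Finite.injective_iff_surjective.1 hf) i
      exact congrFun h j
    · funext j
      have hb : Function.Bijective f := ⟨hf, Finite.injective_iff_surjective.1 hf⟩
      have h1 := congrFun hZ (g j)
      simp only [Matrix.vecMul, dotProduct, Pi.zero_apply] at h1 ⊢
      rw [← h1, ← hb.sum_comp (fun i => v i * Z i (g j))]
      simp
  exact this hf

abbrev KK (k : Type*) [Field k] (r n : ℕ) := FractionRing (SS k r n)

noncomputable def mA (k : Type*) [Field k] (r n : ℕ) : Matrix (Fin (r+1)) (Fin r) (KK k r n) :=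
  Matrix.of fun i l => algebraMap (SS k r n) (KK k r n) (X (i, l))

noncomputable def mB (k : Type*) [Field k] (r n : ℕ) : Matrix (Fin r) (Fin n) (KK k r n) :=
  Matrix.of fun l c => algebraMap (SS k r n) (KK k r n) (C (X (l, c)))

theorem par_KK (f : MvPolynomial (Fin (r+1) × Fin n) k) :
    aeval (fun p : Fin (r+1) × Fin n => (mA k r n * mB k r n) p.1 p.2) f =
      algebraMap (SS k r n) (KK k r n) (par k r n f) := by
  have : (aeval (fun p : Fin (r+1) × Fin n => (mA k r n * mB k r n) p.1 p.2) :
      MvPolynomial (Fin (r+1) × Fin n) k →ₐ[k] KK k r n) =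
      (IsScalarTower.toAlgHom k (SS k r n) (KK k r n)).comp (par k r n) := by
    apply MvPolynomial.algHom_ext
    rintro ⟨i, c⟩
    simp [par_X, Matrix.mul_apply, mA, mB]
  rw [this]; rfl

theorem detA (t : Fin (r+1)) : ((mA k r n).submatrix t.succAbove id).det ≠ 0 := by
  have h1 : (mA k r n).submatrix t.succAbove id = (algebraMap (SS k r n) (KK k r n)).mapMatrix
      (Matrix.of fun i l => X (t.succAbove i, l)) := by
    ext i l; simp [mA]
  rw [h1, ← RingHom.map_det]
  intro h
  have h2 := (IsFractionRing.injective (SS k r n) (KK k r n)) (h.trans (map_zero _).symm)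
  have h3 := congrArg (eval (fun p : Fin (r+1) × Fin r =>
    if p.1 = t.succAbove p.2 then (1 : MvPolynomial (Fin r × Fin n) k) else 0)) h2
  rw [RingHom.map_det, map_zero] at h3
  have h4 : (eval (fun p : Fin (r+1) × Fin r =>
    if p.1 = t.succAbove p.2 then (1 : MvPolynomial (Fin r × Fin n) k) else 0)).mapMatrix
      (Matrix.of fun i l => (X (t.succAbove i, l) : SS k r n)) = 1 := by
    ext1 i l; simp [Matrix.one_apply]
  rw [h4, Matrix.det_one] at h3
  exact one_ne_zero h3

theorem detB (g : Fin r → Fin n) (hg : Function.Injective g) :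
    ((mB k r n).submatrix id g).det ≠ 0 := by
  have h1 : (mB k r n).submatrix id g = ((algebraMap (SS k r n) (KK k r n)).comp C).mapMatrix
      (Matrix.of fun i l => X (i, g l)) := by
    ext i l; simp [mB]
  rw [h1, ← RingHom.map_det]
  intro h
  have h2 := (IsFractionRing.injective (SS k r n) (KK k r n)) (h.trans (map_zero _).symm)
  have h2 := (C_injective _ _) (h2.trans (map_zero _).symm)
  have h3 := congrArg (eval (fun p : Fin r × Fin n => if p.2 = g p.1 then (1 : k) else 0)) h2
  rw [RingHom.map_det, map_zero] at h3
  have h4 : (eval (fun p : Fin r × Fin n => if p.2 = g p.1 then (1 : k) else 0)).mapMatrix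
      (Matrix.of fun i l => (X (i, g l) : MvPolynomial (Fin r × Fin n) k)) = 1 := by
    ext1 i l; simp [Matrix.one_apply, hg.eq_iff, eq_comm]
  rw [h4, Matrix.det_one] at h3
  exact one_ne_zero h3

theorem rigid [CharZero k] (Ω : Finset (Fin (r+1) × Fin n)) (hU : UniquelyCompletable k (r+1) n r Ω)
    (Z : Matrix (Fin (r+1)) (Fin n) (KK k r n))
    (v : Fin (r+1) → KK k r n) (hv : v ≠ 0) (hZ : Matrix.vecMul v Z = 0)
    (v' : Fin (r+1) → KK k r n) (hv' : v' ≠ 0) (hZ' : Matrix.vecMul v' (mA k r n) = 0)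
    (hΩ : ∀ p ∈ Ω, Z p.1 p.2 = (mA k r n * mB k r n) p.1 p.2) : Z = mA k r n * mB k r n := by
  ext i c
  obtain ⟨a, b, ha, hb, hb0, hab⟩ := hU (i, c)
  rw [← map_mul, Ideal.Quotient.eq] at hab
  rw [Ne, Ideal.Quotient.eq_zero_iff_mem] at hb0
  have h1 := kill Z v hv hZ _ hab
  have h2 := kill (mA k r n * mB k r n) v' hv' (by rw [← Matrix.vecMul_vecMul, hZ', Matrix.zero_vecMul])
    _ hab
  have hc : ∀ f ∈ MvPolynomial.supported k (↑Ω : Set (Fin (r+1) × Fin n)),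
      aeval (fun p : Fin (r+1) × Fin n => Z p.1 p.2) f =
      aeval (fun p : Fin (r+1) × Fin n => (mA k r n * mB k r n) p.1 p.2) f := by
    intro f hf
    rw [mem_supported] at hf
    exact eval₂Hom_congr' rfl (fun p hp _ => hΩ p (hf hp)) rfl
  rw [map_sub, map_mul, hc a ha, hc b hb, aeval_X] at h1
  rw [map_sub, map_mul, aeval_X] at h2
  have h3 : aeval (fun p : Fin (r+1) × Fin n => (mA k r n * mB k r n) p.1 p.2) b ≠ 0 := by
    rw [par_KK]
    intro h
    exact hb0 (ker_par b ((IsFractionRing.injective (SS k r n) (KK k r n)) (h.trans (map_zero _).symm)))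
  exact mul_left_cancel₀ h3 (by linear_combination h1 - h2)

theorem exv : ∃ v : Fin (r+1) → KK k r n, (∀ i, v i ≠ 0) ∧ Matrix.vecMul v (mA k r n) = 0 := by
  have h := LinearMap.ker_ne_bot_of_finrank_lt (f := (mA k r n).vecMulLinear) (by simp)
  obtain ⟨v, hv, hv0⟩ := Submodule.exists_mem_ne_zero_of_ne_bot h
  rw [LinearMap.mem_ker, Matrix.vecMulLinear_apply] at hv
  refine ⟨v, fun t ht => hv0 ?_, hv⟩
  have h1 : Matrix.vecMul (fun i => v (t.succAbove i)) ((mA k r n).submatrix t.succAbove id) = 0 := by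
    funext l
    have := congrFun hv l
    simp only [Matrix.vecMul, dotProduct, Fin.sum_univ_succAbove _ t, ht, zero_mul, zero_add] at this ⊢
    exact this
  have h2 := Matrix.eq_zero_of_vecMul_eq_zero (detA t) h1
  funext i
  by_cases hi : i = t
  · rw [hi, ht]; rfl
  · obtain ⟨j, rfl⟩ := Fin.exists_succAbove_eq hi
    exact congrFun h2 j

theorem caseA [CharZero k] (Ω : Finset (Fin (r+1) × Fin n)) (hU : UniquelyCompletable k (r+1) n r Ω)
    (j : Fin n) (α α' : Fin (r+1)) (hne : α ≠ α') (h1 : (α, j) ∉ Ω) (h2 : (α', j) ∉ Ω) : False := by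
  obtain ⟨v, hv, hvA⟩ := exv (k := k) (r := r) (n := n)
  have hv0 : v ≠ 0 := fun h => hv 0 (congrFun h 0)
  obtain ⟨a0, rfl⟩ := Fin.exists_succAbove_eq hne
  set A := mA k r n with hA
  set Nm := A.submatrix α'.succAbove id with hN
  let D : Matrix (Fin r) (Fin n) (KK k r n) := Matrix.of fun l c => if c = j then Nm.adjugate l a0 else 0
  have hD : ∀ i0 c, (A * D) (α'.succAbove i0) c =
      if c = j then (if i0 = a0 then Nm.det else 0) else 0 := by
    intro i0 c
    by_cases hc : c = j
    · have := congrFun (congrFun (Matrix.mul_adjugate Nm) i0) a0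
      simp only [Matrix.mul_apply, Matrix.smul_apply, Matrix.one_apply, smul_eq_mul, mul_ite, mul_one,
        mul_zero] at this
      simp only [hc, if_true, ← this, Matrix.mul_apply]
      simp [D, hN]
    · simp [Matrix.mul_apply, D, hc]
  have hR := rigid Ω hU (A * (mB k r n + D)) v hv0
    (by rw [← Matrix.vecMul_vecMul, hvA, Matrix.zero_vecMul]) v hv0 hvA (by
      rintro ⟨i, c⟩ hp
      show (A * (mB k r n + D)) i c = (A * mB k r n) i c
      rw [Matrix.mul_add, Matrix.add_apply, add_eq_left]
      by_cases hc : c = j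
      · subst hc
        have hi : i ≠ α' := by rintro rfl; exact h2 hp
        obtain ⟨i0, rfl⟩ := Fin.exists_succAbove_eq hi
        rw [hD, if_pos rfl, if_neg]
        rintro rfl; exact h1 hp
      · simp [Matrix.mul_apply, D, hc])
  have h3 := congrFun (congrFun hR (α'.succAbove a0)) j
  rw [Matrix.mul_add, Matrix.add_apply] at h3
  simp only [← hA, add_eq_left] at h3
  rw [hD, if_pos rfl, if_pos rfl] at h3
  exact detA _ h3

theorem caseB [CharZero k] (hrn : r ≤ n) (Ω : Finset (Fin (r+1) × Fin n))
    (hU : UniquelyCompletable k (r+1) n r Ω) (F : Finset (Fin n)) (hF : F.card < r)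
    (hm : ∀ c ∉ F, ∃ i, (i, c) ∉ Ω) : False := by
  classical
  obtain ⟨v, hv, hvA⟩ := exv (k := k) (r := r) (n := n)
  have hv0 : v ≠ 0 := fun h => hv 0 (congrFun h 0)
  obtain ⟨J, hFJ, hJ⟩ := Finset.exists_superset_card_eq hF.le (by simpa using hrn)
  obtain ⟨c0, hc0, hc0F⟩ : ∃ c0 ∈ J, c0 ∉ F := by
    by_contra h
    push Not at h
    have := Finset.card_le_card (show J ⊆ F from h)
    omega
  let g : Fin r → Fin n := J.orderEmbOfFin hJ
  have hg : Function.Injective g := (J.orderEmbOfFin hJ).injective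
  have hgr : ∀ c ∈ J, ∃ l, g l = c := by
    intro c hc
    have : c ∈ Set.range (J.orderEmbOfFin hJ) := by rw [Finset.range_orderEmbOfFin]; exact hc
    exact this
  obtain ⟨l0, hl0⟩ := hgr c0 hc0
  set A := mA k r n with hA
  set B := mB k r n with hB
  set Bg := B.submatrix id g with hBg
  let y : Fin r → KK k r n := fun l => Bg.adjugate l0 l
  have hy : ∀ l, Matrix.vecMul y B (g l) = if l0 = l then Bg.det else 0 := by
    intro l
    have := congrFun (congrFun (Matrix.adjugate_mul Bg) l0) l
    simp only [Matrix.mul_apply, Matrix.smul_apply, Matrix.one_apply, smul_eq_mul, mul_ite, mul_one,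
      mul_zero] at this
    rw [← this]
    rfl
  obtain ⟨w, hw⟩ : ∃ w, Matrix.vecMul w A = y := by
    refine ⟨Fin.cons 0 (Matrix.vecMul y (A.submatrix (0 : Fin (r+1)).succAbove id)⁻¹), ?_⟩
    have h1 : Matrix.vecMul (Matrix.vecMul y (A.submatrix (0 : Fin (r+1)).succAbove id)⁻¹)
        (A.submatrix (0 : Fin (r+1)).succAbove id) = y := by
      rw [Matrix.vecMul_vecMul, Matrix.nonsing_inv_mul _ (detA 0).isUnit, Matrix.vecMul_one]
    funext l
    have h2 := congrFun h1 l
    rw [← h2]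
    conv_lhs => rw [Matrix.vecMul, dotProduct, Fin.sum_univ_succ]
    simp only [Fin.cons_zero, zero_mul, zero_add, Fin.cons_succ]
    rfl
  haveI : Infinite (KK k r n) :=
    Infinite.of_injective (algebraMap k (KK k r n)) (algebraMap k (KK k r n)).injective
  obtain ⟨t, ht⟩ := Infinite.exists_notMem_finset (Finset.univ.image fun i => - w i / v i)
  let v' : Fin (r+1) → KK k r n := w + t • v
  have hv' : ∀ i, v' i ≠ 0 := by
    intro i hi
    apply ht
    refine Finset.mem_image.2 ⟨i, Finset.mem_univ _, ?_⟩
    rw [div_eq_iff (hv i)]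
    simp only [v', Pi.add_apply, Pi.smul_apply, smul_eq_mul] at hi
    linear_combination -hi
  have hv'A : Matrix.vecMul v' (A * B) = Matrix.vecMul y B := by
    rw [← Matrix.vecMul_vecMul, Matrix.add_vecMul, Matrix.smul_vecMul, hw, hvA, smul_zero, add_zero]
  have hex : ∀ c, ∃ i, c ∉ F → (i, c) ∉ Ω := by
    intro c
    by_cases hc : c ∈ F
    · exact ⟨0, fun h => absurd hc h⟩
    · obtain ⟨i, hi⟩ := hm c hc
      exact ⟨i, fun _ => hi⟩
  choose al hal using hex
  let Z : Matrix (Fin (r+1)) (Fin n) (KK k r n) := Matrix.of fun i c =>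
    if c ∈ F then (A * B) i c else if i = al c then
      -(∑ i ∈ Finset.univ.erase (al c), v' i * (A * B) i c) / v' (al c) else (A * B) i c
  have hZ : Matrix.vecMul v' Z = 0 := by
    funext c
    by_cases hc : c ∈ F
    · have h1 : Matrix.vecMul v' Z c = Matrix.vecMul v' (A * B) c := by
        simp [Matrix.vecMul, dotProduct, Z, hc]
      obtain ⟨l, rfl⟩ := hgr c (hFJ hc)
      rw [h1, hv'A, hy, if_neg]
      · rfl
      · rintro rfl; exact hc0F (hl0 ▸ hc)
    · simp only [Matrix.vecMul, dotProduct, Pi.zero_apply]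
      rw [← Finset.add_sum_erase _ _ (Finset.mem_univ (al c))]
      have h2 : ∑ i ∈ Finset.univ.erase (al c), v' i * Z i c =
          ∑ i ∈ Finset.univ.erase (al c), v' i * (A * B) i c := by
        refine Finset.sum_congr rfl fun i hi => ?_
        simp only [Z, Matrix.of_apply, if_neg hc, if_neg (Finset.ne_of_mem_erase hi)]
      rw [h2]
      simp only [Z, Matrix.of_apply, if_neg hc, if_true]
      rw [mul_div_cancel₀ _ (hv' _), neg_add_cancel]
  have hR := rigid Ω hU Z v' (fun h => hv' 0 (congrFun h 0)) hZ v hv0 hvA (by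
    rintro ⟨i, c⟩ hp
    by_cases hc : c ∈ F
    · simp [Z, hc, hA, hB]
    · have : i ≠ al c := by rintro rfl; exact hal c hc hp
      simp [Z, hc, this, hA, hB])
  rw [← hA, ← hB] at hR
  have h5 := congrFun hZ (g l0)
  rw [hR, hv'A, hy, if_pos rfl] at h5
  exact detB g hg h5

theorem card_col (Ω : Finset (Fin (r+1) × Fin n)) (j : Fin n) :
    (Ω.filter fun p => p.2 = j).card + (Finset.univ.filter fun i => (i, j) ∉ Ω).card = r + 1 := by
  have h1 : (Ω.filter fun p => p.2 = j).card = (Finset.univ.filter fun i => (i, j) ∈ Ω).card := by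
    refine Finset.card_bij' (fun p _ => p.1) (fun i _ => (i, j)) ?_ ?_ ?_ ?_
    · rintro ⟨i, c⟩ h; simp at h ⊢; rw [← h.2]; exact h.1
    · intro i h; simpa using h
    · rintro ⟨i, c⟩ h; simp at h ⊢; exact h.2.symm
    · intro i h; rfl
  rw [h1, Finset.card_filter_add_card_filter_not]
  simp

theorem det_supp (Ω : Set (Fin (r+1) × Fin n)) {s : ℕ} (M : Matrix (Fin s) (Fin s)
    (MvPolynomial (Fin (r+1) × Fin n) k)) (h : ∀ i j, M i j ∈ supported k Ω) :
    M.det ∈ supported k Ω := by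
  rw [Matrix.det_apply]
  refine Subalgebra.sum_mem _ fun σ _ => ?_
  rw [Units.smul_def]
  exact Subalgebra.zsmul_mem _ (Subalgebra.prod_mem _ fun i _ => h _ _) _

theorem suff (Ω : Finset (Fin (r+1) × Fin n))
    (h1 : ∀ j : Fin n, r ≤ (Ω.filter fun p => p.2 = j).card)
    (J : Finset (Fin n)) (hJ : J.card = r) (hJΩ : ∀ i : Fin (r+1), ∀ j ∈ J, (i, j) ∈ Ω) :
    UniquelyCompletable k (r+1) n r Ω := by
  rintro ⟨α, β⟩
  let g : Fin r → Fin n := J.orderEmbOfFin hJ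
  have hg : Function.Injective g := (J.orderEmbOfFin hJ).injective
  have hgJ : ∀ l, g l ∈ J := fun l => J.orderEmbOfFin_mem hJ l
  -- the `r`-minor avoiding row `α`
  let b : MvPolynomial (Fin (r+1) × Fin n) k :=
    (Matrix.of fun i l => (X (α.succAbove i, g l) : MvPolynomial (Fin (r+1) × Fin n) k)).det
  have hb : b ∉ detIdeal k (r+1) n r := by
    intro hb
    have h2 := kill (T := k) (Matrix.of fun i c => if ∃ l, i = α.succAbove l ∧ c = g l then 1 else 0)
      (Pi.single α 1) (by simp) (by
        funext c
        simp only [Matrix.vecMul, dotProduct, Pi.zero_apply, Matrix.of_apply]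
        refine Finset.sum_eq_zero fun i _ => ?_
        by_cases h : i = α
        · subst h
          rw [if_neg, mul_zero]
          rintro ⟨l, hl, _⟩
          exact Fin.succAbove_ne i l hl.symm
        · rw [Pi.single_eq_of_ne h, zero_mul]) b hb
    rw [AlgHom.map_det] at h2
    have h3 : (aeval (R := k) fun p : Fin (r+1) × Fin n => (Matrix.of fun i c =>
        if ∃ l, i = α.succAbove l ∧ c = g l then (1 : k) else 0 : Matrix _ _ k) p.1 p.2).mapMatrix
        (Matrix.of fun i l => (X (α.succAbove i, g l) : MvPolynomial (Fin (r+1) × Fin n) k)) = 1 := by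
      ext1 i l
      simp [Matrix.one_apply, hg.eq_iff, eq_comm]
    rw [h3, Matrix.det_one] at h2
    exact one_ne_zero h2
  by_cases hp : (α, β) ∈ Ω
  · refine ⟨X (α, β) * b, b, Subalgebra.mul_mem _ ?_ ?_, ?_, ?_, ?_⟩
    · exact X_mem_supported.2 hp
    · exact det_supp _ _ fun i l => X_mem_supported.2 (hJΩ _ _ (hgJ l))
    · exact det_supp _ _ fun i l => X_mem_supported.2 (hJΩ _ _ (hgJ l))
    · rwa [Ne, Ideal.Quotient.eq_zero_iff_mem]
    · rw [← map_mul, mul_comm]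
  · have hβ : β ∉ J := fun h => hp (hJΩ _ _ h)
    have hβΩ : ∀ i, i ≠ α → (i, β) ∈ Ω := by
      intro i hi
      by_contra h
      have h2 : ({i, α} : Finset (Fin (r+1))) ⊆ Finset.univ.filter fun i => (i, β) ∉ Ω := by
        intro x hx
        simp only [Finset.mem_insert, Finset.mem_singleton] at hx
        rcases hx with rfl | rfl <;> simpa
      have h3 := Finset.card_le_card h2
      rw [Finset.card_pair hi] at h3
      have := card_col Ω β
      have := h1 β
      omega
    have hgc : Function.Injective (Fin.cons β g : Fin (r+1) → Fin n) := by
      rw [Fin.cons_injective_iff]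
      refine ⟨?_, hg⟩
      rintro ⟨l, rfl⟩; exact hβ (hgJ l)
    have hdet : (Matrix.of fun i j => (X (i, (Fin.cons β g : Fin (r+1) → Fin n) j) :
        MvPolynomial (Fin (r+1) × Fin n) k)).det ∈ detIdeal k (r+1) n r :=
      Ideal.subset_span ⟨id, _, Function.injective_id, hgc, rfl⟩
    rw [Matrix.det_succ_column_zero, Fin.sum_univ_succAbove _ α] at hdet
    refine ⟨- ((-1) ^ (α : ℕ) * ∑ i : Fin r, (-1) ^ ((α.succAbove i : Fin (r+1)) : ℕ) *
      X (α.succAbove i, β) * (Matrix.of fun i' l =>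
        (X ((α.succAbove i).succAbove i', g l) : MvPolynomial (Fin (r+1) × Fin n) k)).det),
      b, ?_, ?_, ?_, ?_⟩
    · refine Subalgebra.neg_mem _ (Subalgebra.mul_mem _ ?_ (Subalgebra.sum_mem _ fun i _ =>
        Subalgebra.mul_mem _ (Subalgebra.mul_mem _ ?_ ?_) ?_))
      · exact Subalgebra.pow_mem _ (Subalgebra.neg_mem _ (Subalgebra.one_mem _)) _
      · exact Subalgebra.pow_mem _ (Subalgebra.neg_mem _ (Subalgebra.one_mem _)) _
      · exact X_mem_supported.2 (hβΩ _ (Fin.succAbove_ne _ _))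
      · exact det_supp _ _ fun i l => X_mem_supported.2 (hJΩ _ _ (hgJ l))
    · exact det_supp _ _ fun i l => X_mem_supported.2 (hJΩ _ _ (hgJ l))
    · rwa [Ne, Ideal.Quotient.eq_zero_iff_mem]
    · rw [← map_mul, Ideal.Quotient.eq]
      have h4 := Ideal.mul_mem_left _ ((-1) ^ (α : ℕ)) hdet
      have h5 : ((-1 : MvPolynomial (Fin (r+1) × Fin n) k) ^ (α : ℕ)) * (-1) ^ (α : ℕ) = 1 := by
        rw [← mul_pow]; simp
      convert h4 using 1
      rw [sub_neg_eq_add, mul_add]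
      congr 1
      rw [← mul_assoc, ← mul_assoc, h5, one_mul, mul_comm]
      rfl

end main

end UC

/-- Codimension one: with `m ≤ n`, a set `Ω ⊆ [m] × [n]` is uniquely completable at rank
`m - 1` iff every column of `Ω` has at least `m - 1` observed entries and `Ω` contains
`m - 1` fully observed columns `[m] × J`. -/
theorem uniquelyCompletable_codim_one {k : Type*} [Field k] [CharZero k]
    {m n : ℕ} (hm : 1 ≤ m) (hmn : m ≤ n) (Ω : Finset (Fin m × Fin n)) :
    UniquelyCompletable k m n (m - 1) Ω ↔
      ((∀ j : Fin n, m - 1 ≤ (Ω.filter fun p => p.2 = j).card) ∧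
       ∃ J : Finset (Fin n), J.card = m - 1 ∧ ∀ i : Fin m, ∀ j ∈ J, (i, j) ∈ Ω) := by
  obtain ⟨r, rfl⟩ : ∃ r, m = r + 1 := ⟨m - 1, by omega⟩
  rw [Nat.add_sub_cancel]
  constructor
  · intro hU
    constructor
    · intro j
      by_contra h
      have h1 := UC.card_col Ω j
      have h2 : 1 < (Finset.univ.filter fun i => (i, j) ∉ Ω).card := by omega
      obtain ⟨a, ha, b, hb, hab⟩ := Finset.one_lt_card.1 h2
      simp only [Finset.mem_filter, Finset.mem_univ, true_and] at ha hb
      exact UC.caseA Ω hU j a b hab ha hb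
    · by_contra h
      have hF : (Finset.univ.filter fun j : Fin n => ∀ i, (i, j) ∈ Ω).card < r := by
        by_contra hlt
        obtain ⟨J, hJ, hJr⟩ := Finset.exists_subset_card_eq (not_lt.1 hlt)
        refine h ⟨J, hJr, fun i j hj => ?_⟩
        have := hJ hj
        simp only [Finset.mem_filter, Finset.mem_univ, true_and] at this
        exact this i
      refine UC.caseB (by omega) Ω hU _ hF fun c hc => ?_
      simpa using hc
  · rintro ⟨h1, J, hJ, h2⟩
    exact UC.suff Ω h1 J hJ h2
end
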